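/- For d = 4, b = 2 (the pushforward of O_{ℙ²}(2) under the 4-uple embedding): dim K_{p,0}(ℙ²,2;4) for p = 0,…,5 equals 6, 62, 276, 660, 825, 252 respectively; dim K_{p,1}(ℙ²,2;4) for p = 3,…,12 equals 55, 450, 2376, 4488, 4950, 3630, 1804, 588, 114, 10 respectively; and K_{p,q}(ℙ²,2;4) = 0 for all other pairs (p,q) with p ≥ 0 and q ∈ ℤ. -/

import Mathlib

open scoped TensorProduct

set_option maxHeartbeats 2000000
set_option synthInstance.maxHeartbeats 1000000

noncomputable section

/-- The dimension (over `ℂ`) of a complex vector space, as a natural number. -/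
def cdim (M : Type*) [AddCommMonoid M] [Module ℂ M] : ℕ := (Module.rank ℂ M).toNat

/-- The polynomial ring `S = ℂ[x₀,…,x_{N-1}]`. -/
abbrev PolyC (N : ℕ) : Type := MvPolynomial (Fin N) ℂ

/-- The space `S_e` of homogeneous polynomials of degree `e` (zero for `e < 0`). -/
def Sdeg (N : ℕ) (e : ℤ) : Submodule ℂ (PolyC N) :=
  if 0 ≤ e then MvPolynomial.homogeneousSubmodule (Fin N) ℂ e.toNat else ⊥

/-- The monomial `x^σ`. -/
def monoC (N : ℕ) (σ : Fin N →₀ ℕ) : PolyC N := MvPolynomial.monomial σ (1 : ℂ)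

/-- The wedge product `m₁ ∧ ⋯ ∧ mₙ` as an element of the `n`-th exterior power. -/
def wedgeE (R : Type*) [CommRing R] (M : Type*) [AddCommGroup M] [Module R M]
    (n : ℕ) (m : Fin n → M) : ↥(⋀[R]^n M) :=
  ⟨ExteriorAlgebra.ιMulti R n m, ExteriorAlgebra.ιMulti_range R n ⟨m, rfl⟩⟩

/-- The module `⋀^p S_d ⊗ S_e`. -/
abbrev KosModule (N : ℕ) (d : ℤ) (p : ℕ) (e : ℤ) : Type :=
  (↥(⋀[ℂ]^p ↥(Sdeg N d))) ⊗[ℂ] ↥(Sdeg N e)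

/-- `D` satisfies the defining formula of the Koszul differential
`∂_{p+1} : ⋀^{p+1} S_d ⊗ S_e → ⋀^p S_d ⊗ S_{e'}` (for `e' = e + d`), namely
`∂(m₁∧⋯∧m_{p+1} ⊗ f) = ∑ₖ (−1)ᵏ m₁∧⋯∧m̂ₖ∧⋯∧m_{p+1} ⊗ (mₖ·f)`; the equality is
stated after applying the (injective) inclusion `⋀^p S_d ⊗ S_{e'} → ⋀^p S_d ⊗ S`. -/
def IsKoszulDiff (N : ℕ) (d e e' : ℤ) (p : ℕ)
    (D : KosModule N d (p + 1) e →ₗ[ℂ] KosModule N d p e') : Prop :=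
  ∀ (m : Fin (p + 1) → ↥(Sdeg N d)) (f : ↥(Sdeg N e)),
    TensorProduct.map (LinearMap.id (R := ℂ) (M := ↥(⋀[ℂ]^p ↥(Sdeg N d)))) (Sdeg N e').subtype
        (D (wedgeE ℂ ↥(Sdeg N d) (p + 1) m ⊗ₜ[ℂ] f)) =
      ∑ k : Fin (p + 1), ((-1 : ℂ) ^ ((k : ℕ) + 1)) •
        (wedgeE ℂ ↥(Sdeg N d) p (fun i => m (Fin.succAbove k i)) ⊗ₜ[ℂ]
          ((m k : PolyC N) * (f : PolyC N)))

/-- A family of maps of the shape of the Koszul differentials. -/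
def KFam (N : ℕ) (d : ℤ) : Type :=
  ∀ (p : ℕ) (e e' : ℤ), KosModule N d (p + 1) e →ₗ[ℂ] KosModule N d p e'

/-- The family `D` consists of the Koszul differentials (at all meaningful degrees). -/
def IsKoszulFam (N : ℕ) (d : ℤ) (D : KFam N d) : Prop :=
  ∀ (p : ℕ) (e e' : ℤ), e' = e + d → IsKoszulDiff N d e e' p (D p e e')

/-- `dim K_{p,q}(ℙ^{N-1}, b; d)`: the dimension of the homology `ker ∂_p / im ∂_{p+1}` at the
middle term of `⋀^{p+1} S_d ⊗ S_{b+(q-1)d} → ⋀^p S_d ⊗ S_{b+qd} → ⋀^{p-1} S_d ⊗ S_{b+(q+1)d}`,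
where for `p = 0` the right-hand map is the zero map (the dimension of the quotient is expressed
as `dim ker − dim (im ⊓ ker)`, which agrees with it since all spaces here are
finite-dimensional). -/
def Kdim (N : ℕ) (d : ℤ) (D : KFam N d) (b : ℤ) : ℕ → ℤ → ℕ
  | 0, q =>
      cdim (KosModule N d 0 (b + q * d)) -
        cdim ↥(LinearMap.range (D 0 (b + (q - 1) * d) (b + q * d)))
  | p + 1, q =>
      cdim ↥(LinearMap.ker (D p (b + q * d) (b + (q + 1) * d))) -
        cdim
          ↥(LinearMap.range (D (p + 1) (b + (q - 1) * d) (b + q * d)) ⊓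
            LinearMap.ker (D p (b + q * d) (b + (q + 1) * d)))

/-- The multidegree-`a` component of `⋀^p S_d ⊗ S_e`: the span of the pure tensors
`m₁∧⋯∧m_p ⊗ f` with the `mᵢ` and `f` monomials of total multidegree `a`. -/
def KComp (N : ℕ) (d : ℤ) (p : ℕ) (e : ℤ) (a : Fin N →₀ ℕ) :
    Submodule ℂ (KosModule N d p e) :=
  Submodule.span ℂ
    { x | ∃ (σ : Fin p → (Fin N →₀ ℕ)) (τ : Fin N →₀ ℕ)
        (hσ : ∀ i, monoC N (σ i) ∈ Sdeg N d) (hτ : monoC N τ ∈ Sdeg N e),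
        (∑ i, σ i) + τ = a ∧
        x = wedgeE ℂ ↥(Sdeg N d) p (fun i => (⟨monoC N (σ i), hσ i⟩ : ↥(Sdeg N d))) ⊗ₜ[ℂ]
            (⟨monoC N τ, hτ⟩ : ↥(Sdeg N e)) }

/-- `dim K_{p,q}(ℙ^{N-1}, b; d)_a`: the dimension of the multidegree-`a` component of the
homology, i.e. of `(ker ∂_p ∩ (⋀^p S_d ⊗ S_{b+qd})_a) / (im ∂_{p+1} ∩ (⋀^p S_d ⊗ S_{b+qd})_a)`
(again expressed as a difference of dimensions). -/
def KdimA (N : ℕ) (d : ℤ) (D : KFam N d) (b : ℤ) : ℕ → ℤ → (Fin N →₀ ℕ) → ℕ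
  | 0, q, a =>
      cdim ↥(KComp N d 0 (b + q * d) a) -
        cdim
          ↥(LinearMap.range (D 0 (b + (q - 1) * d) (b + q * d)) ⊓ KComp N d 0 (b + q * d) a)
  | p + 1, q, a =>
      cdim
        ↥(LinearMap.ker (D p (b + q * d) (b + (q + 1) * d)) ⊓ KComp N d (p + 1) (b + q * d) a) -
        cdim
          ↥(LinearMap.range (D (p + 1) (b + (q - 1) * d) (b + q * d)) ⊓
            (LinearMap.ker (D p (b + q * d) (b + (q + 1) * d)) ⊓
              KComp N d (p + 1) (b + q * d) a))

/-- Build a multidegree in `Fin 3 →₀ ℕ` from three exponents. -/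
def mdeg3 (i j k : ℕ) : Fin 3 →₀ ℕ := Finsupp.equivFunOnFinite.symm ![i, j, k]

end

noncomputable section

namespace VB

inductive Vec where
  | nil : Vec
  | cons : ℕ → ℤ → Vec → Vec

def scons (k : ℕ) (c : ℤ) (r : Vec) : Vec :=
  Vec.rec (motive := fun _ => Vec) (Vec.cons k c Vec.nil)
    (fun k' c' t _ => Vec.cons k c (Vec.cons k' c' t)) r

def pushNZ (k : ℕ) (v : ℤ) (r : Vec) : Vec :=
  Int.rec (motive := fun _ => Vec)
    (fun n => Nat.rec (motive := fun _ => Vec) r (fun m _ => scons k (Int.ofNat (Nat.succ m)) r) n)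
    (fun n => Nat.rec (motive := fun _ => Vec) (scons k (Int.negSucc 0) r)
      (fun m _ => scons k (Int.negSucc (Nat.succ m)) r) n) v

def mapV (g : ℤ → ℤ) (x : Vec) : Vec :=
  Vec.rec (motive := fun _ => Vec) Vec.nil (fun k c _ ih => pushNZ k (g c) ih) x

def mrg3 (f : ℤ → ℤ → ℤ) (g : ℤ → ℤ) (ih : Vec → Vec → Vec) (x q : Vec)
    (k : ℕ) (c : ℤ) (t : Vec) (k' : ℕ) (c' : ℤ) (t' : Vec) : Vec :=
  Bool.rec (motive := fun _ => Vec)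
    (Bool.rec (motive := fun _ => Vec)
      (pushNZ k' (g c') (ih x t')) (scons k c (ih t q)) (Nat.ble k' k))
    (pushNZ k (f c c') (ih t t')) (Nat.beq k k')

def mrg2 (f : ℤ → ℤ → ℤ) (g : ℤ → ℤ) (ih : Vec → Vec → Vec) (x q : Vec)
    (k' : ℕ) (c' : ℤ) (t' : Vec) : Vec :=
  Vec.rec (motive := fun _ => Vec) (mapV g q) (fun k c t _ => mrg3 f g ih x q k c t k' c' t') x

def mrg1 (f : ℤ → ℤ → ℤ) (g : ℤ → ℤ) (ih : Vec → Vec → Vec) (x q : Vec) : Vec :=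
  Vec.rec (motive := fun _ => Vec) x (fun k' c' t' _ => mrg2 f g ih x q k' c' t') q

def app (x q : Vec) : Vec :=
  Vec.rec (motive := fun _ => Vec) q (fun k c _ ih => Vec.cons k c ih) x

def mrg (f : ℤ → ℤ → ℤ) (g : ℤ → ℤ) (fuel : ℕ) : Vec → Vec → Vec :=
  Nat.rec (motive := fun _ => Vec → Vec → Vec)
    (fun x q => app x (mapV g q)) (fun _ ih x q => mrg1 f g ih x q) fuel

inductive Tr where
  | e : Tr
  | l : Vec → Tr
  | n : Tr → Tr → Tr

def leaf (t : Tr) : Vec := Tr.rec (motive := fun _ => Vec) Vec.nil (fun v => v) (fun _ _ _ _ => Vec.nil) t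

def look (path : List ℕ) (k : ℕ) : Tr → Vec :=
  List.rec (motive := fun _ => Tr → Vec) leaf
    (fun b _ ih t => Tr.rec (motive := fun _ => Vec) Vec.nil (fun _ => Vec.nil)
      (fun t0 t1 _ _ => Nat.rec (motive := fun _ => Vec) (ih t0) (fun _ _ => ih t1) (Nat.land k b)) t)
    path

def snode0 (a b : Tr) : Tr := Tr.rec (motive := fun _ => Tr) (Tr.n a b)
  (fun v => Tr.n (Tr.l v) b) (fun x y _ _ => Tr.n (Tr.n x y) b) a
def snode1 (a b : Tr) : Tr := Tr.rec (motive := fun _ => Tr) (Tr.n a b)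
  (fun v => Tr.n a (Tr.l v)) (fun x y _ _ => Tr.n a (Tr.n x y)) b

def ins1 (ih : Tr → Tr) (k b : ℕ) (t0 t1 : Tr) : Tr :=
  Nat.rec (motive := fun _ => Tr) (snode0 (ih t0) t1) (fun _ _ => snode1 t0 (ih t1)) (Nat.land k b)

def ins (path : List ℕ) (k : ℕ) (v : Vec) : Tr → Tr :=
  List.rec (motive := fun _ => Tr → Tr)
    (fun _ => Tr.l v)
    (fun b _ ih t => Tr.rec (motive := fun _ => Tr) (ins1 ih k b Tr.e Tr.e)
      (fun _ => t) (fun t0 t1 _ _ => ins1 ih k b t0 t1) t)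
    path

def isz (z : ℤ) : Bool := Int.rec (motive := fun _ => Bool) (fun n => Nat.beq n 0) (fun _ => false) z

def redGen2 (x q : Vec) (s m : ℤ) : Vec :=
  Bool.rec (motive := fun _ => Vec)
    (mrg (fun u v => Int.sub u (Int.mul m v)) (fun v => Int.neg (Int.mul m v)) 1000
      (mapV (fun u => Int.mul s u) x) q) x (isz s)

def redGen (x q : Vec) (c d : ℤ) : Vec :=
  redGen2 x q (d / Int.gcd c d) (c / Int.gcd c d)

/-- one reduction step -/
def red1 (x q : Vec) (c d : ℤ) : Vec :=
  Bool.rec (motive := fun _ => Vec)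
    (Bool.rec (motive := fun _ => Vec) (redGen x q c d)
      (mrg Int.add (fun v => v) 1000 x q) (isz (Int.add c d)))
    (mrg Int.sub Int.neg 1000 x q) (isz (Int.sub c d))

def reduce2 (ih : Vec → Vec) (x : Vec) (c : ℤ) (q : Vec) : Vec :=
  Vec.rec (motive := fun _ => Vec) x (fun _ d _ _ => ih (red1 x q c d)) q

def reduce (path : List ℕ) (t : Tr) (fuel : ℕ) : Vec → Vec :=
  Nat.rec (motive := fun _ => Vec → Vec) (fun x => x)
    (fun _ ih x => Vec.rec (motive := fun _ => Vec) Vec.nil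
      (fun k c _ _ => reduce2 ih x c (look path k t)) x) fuel

def forceT (f : Tr → ℕ → Tr × ℕ) (n : ℕ) (t : Tr) : Tr × ℕ :=
  Tr.rec (motive := fun _ => Tr × ℕ) (f Tr.e n) (fun v => f (Tr.l v) n) (fun a b _ _ => f (Tr.n a b) n) t

def step (path : List ℕ) (ih : Tr → ℕ → Tr × ℕ) (t : Tr) (n : ℕ) (r : Vec) : Tr × ℕ :=
  Vec.rec (motive := fun _ => Tr × ℕ) (ih t n)
      (fun k _ _ _ => forceT ih (Nat.succ n) (ins path k r t)) r

def run (path : List ℕ) (rows : List Vec) : Tr → ℕ → Tr × ℕ :=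
  List.rec (motive := fun _ => Tr → ℕ → Tr × ℕ) (fun t n => (t, n))
    (fun x _ ih t n => step path ih t n (reduce path t 1000 x)) rows

def items : List (ℕ × ℕ) :=
  [(2^17, 18), (2^16, 67), (2^15, 130), (2^14, 193), (2^13, 200), (2^12, 144),
   (2^11, 81), (2^10, 88), (2^9, 25), (2^8, 74), (2^7, 11), (2^6, 137)]

def subs (vs : List (ℕ × ℕ)) : ℕ → List (ℕ × ℕ) → List (List (ℕ × ℕ)) :=
  List.rec (motive := fun _ => ℕ → List (ℕ × ℕ) → List (List (ℕ × ℕ)))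
    (fun p acc => Nat.rec (motive := fun _ => List (List (ℕ × ℕ))) [acc] (fun _ _ => []) p)
    (fun v _ ih p acc => Nat.rec (motive := fun _ => List (List (ℕ × ℕ))) [acc]
      (fun p' _ => ih (Nat.succ p') acc ++ ih p' (v :: acc)) p) vs

def tot (l : List (ℕ × ℕ)) : ℕ := List.rec (motive := fun _ => ℕ) 0 (fun v _ ih => v.1 + ih) l

def srow (k : ℕ) (s : ℤ) (r : Vec) : Vec :=
  Nat.rec (motive := fun _ => Vec) (scons 0 s r) (fun m _ => scons (Nat.succ m) s r) k

def rowAux (K f : ℕ) (l : List (ℕ × ℕ)) : Bool → Vec :=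
  List.rec (motive := fun _ => Bool → Vec) (fun _ => Vec.nil)
    (fun v _ ih s => Nat.rec (motive := fun _ => Vec)
      (srow (K - v.1 + (v.2 + f) % 64) (Bool.rec (motive := fun _ => ℤ) (Int.negSucc 0) (Int.ofNat 1) s) (ih (not s))) (fun _ _ => ih (not s)) (Nat.land (v.2 + f) 292)) l

def fs : List ℕ := [128, 72, 65, 16, 9, 2]

def rows (p : ℕ) : List Vec := (subs items p []).flatMap fun l => fs.map fun f => rowAux (tot l) f l false

def path : List ℕ := [2^17,2^16,2^15,2^14,2^13,2^12,2^11,2^10,2^9,2^8,2^7,2^6,16,8,2,1]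

/-- flatten a trie, larger keys first -/
def flat (t : Tr) : List Vec → List Vec :=
  Tr.rec (motive := fun _ => List Vec → List Vec) (fun acc => acc) (fun v acc => v :: acc)
    (fun _ _ iha ihb acc => ihb (iha acc)) t

def band (a : Bool) (b : Bool) : Bool := Bool.rec (motive := fun _ => Bool) false b a

def desc (x : Vec) : ℕ → Bool :=
  Vec.rec (motive := fun _ => ℕ → Bool) (fun _ => true)
    (fun k _ _ ih b => band (Nat.ble (Nat.succ k) b) (ih k)) x

def chkL (r : ℕ) (l : List Vec) : ℕ → ℕ → Bool :=
  List.rec (motive := fun _ => ℕ → ℕ → Bool) (fun _ n => Nat.beq n r)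
    (fun v _ ih b n => Vec.rec (motive := fun _ => Bool) false
      (fun k c t _ => band (Nat.ble (Nat.succ k) b) (band (not (isz c)) (band (desc t k)
        (ih k (Nat.succ n))))) v) l

def chkF (r : ℕ) (s : Tr × ℕ) : Bool :=
  Prod.rec (motive := fun _ => Bool)
    (fun t n => band (Nat.beq n r) (chkL r (flat t []) 1000000 0)) s

def chk (p r : ℕ) : Bool := chkF r (run path (rows p) Tr.e 0)

/-- the vector denoted by a sparse list -/
def ev (x : Vec) : ℕ →₀ ℂ :=
  Vec.rec (motive := fun _ => ℕ →₀ ℂ) 0 (fun k c _ ih => Finsupp.single k (c : ℂ) + ih) x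

theorem ev_nil : ev Vec.nil = 0 := rfl
theorem ev_cons (k : ℕ) (c : ℤ) (t : Vec) :
    ev (Vec.cons k c t) = Finsupp.single k (c : ℂ) + ev t := rfl

theorem scons_eq (k : ℕ) (c : ℤ) (r : Vec) : scons k c r = Vec.cons k c r := by
  cases r <;> rfl

theorem ev_pushNZ (k : ℕ) (v : ℤ) (r : Vec) :
    ev (pushNZ k v r) = Finsupp.single k (v : ℂ) + ev r := by
  rcases v with (_ | n) | (_ | n)
  · change ev r = _
    simp
  · change ev (scons k _ r) = _
    rw [scons_eq, ev_cons]
  · change ev (scons k _ r) = _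
    rw [scons_eq, ev_cons]
  · change ev (scons k _ r) = _
    rw [scons_eq, ev_cons]

theorem ev_mapV (g : ℤ → ℤ) (μ : ℂ) (hg : ∀ c, ((g c : ℤ) : ℂ) = μ * c) (x : Vec) :
    ev (mapV g x) = μ • ev x := by
  induction x with
  | nil => simp [mapV, ev]
  | cons k c t ih =>
    change ev (pushNZ k (g c) (mapV g t)) = _
    rw [ev_pushNZ, ih, ev_cons, smul_add, hg, Finsupp.smul_single, smul_eq_mul]

theorem ev_app (x q : Vec) : ev (app x q) = ev x + ev q := by
  induction x with
  | nil => simp [app, ev]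
  | cons k c t ih =>
    change ev (Vec.cons k c (app t q)) = _
    rw [ev_cons, ih, ev_cons, add_assoc]

theorem ev_mrg (f : ℤ → ℤ → ℤ) (g : ℤ → ℤ) (μ : ℂ) (hg : ∀ c, ((g c : ℤ) : ℂ) = μ * c)
    (hf : ∀ c c', ((f c c' : ℤ) : ℂ) = c + μ * c') (n : ℕ) :
    ∀ x q : Vec, ev (mrg f g n x q) = ev x + μ • ev q := by
  induction n with
  | zero =>
    intro x q
    change ev (app x (mapV g q)) = _
    rw [ev_app, ev_mapV g μ hg]
  | succ n ih =>
    intro x q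
    change ev (mrg1 f g (mrg f g n) x q) = _
    rcases q with _ | ⟨k', c', t'⟩
    · change ev x = _
      simp [ev_nil]
    change ev (mrg2 f g (mrg f g n) x (Vec.cons k' c' t') k' c' t') = _
    rcases x with _ | ⟨k, c, t⟩
    · change ev (mapV g (Vec.cons k' c' t')) = _
      rw [ev_mapV g μ hg, ev_nil, zero_add]
    change ev (mrg3 f g (mrg f g n) (Vec.cons k c t) (Vec.cons k' c' t') k c t k' c' t') = _
    unfold mrg3
    cases h : Nat.beq k k' with
    | true =>
      have hk : k = k' := Nat.eq_of_beq_eq_true h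
      subst hk
      change ev (pushNZ k (f c c') (mrg f g n t t')) = _
      rw [ev_pushNZ, ih, hf, ev_cons, ev_cons, smul_add, Finsupp.smul_single, Finsupp.single_add,
        smul_eq_mul]
      abel
    | false =>
      cases Nat.ble k' k with
      | true =>
        change ev (scons k c (mrg f g n t (Vec.cons k' c' t'))) = _
        rw [scons_eq, ev_cons, ih, ev_cons k c t, add_assoc]
      | false =>
        change ev (pushNZ k' (g c') (mrg f g n (Vec.cons k c t) t')) = _
        rw [ev_pushNZ, ih, hg, ev_cons k' c' t', smul_add, Finsupp.smul_single, smul_eq_mul]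
        abel

theorem isz_true {z : ℤ} (h : isz z = true) : z = 0 := by
  rcases z with n | n
  · change Nat.beq n 0 = true at h
    have := Nat.eq_of_beq_eq_true h
    subst this; rfl
  · exact absurd h (by simp [isz])

theorem isz_false {z : ℤ} (h : isz z = false) : z ≠ 0 := by
  rintro rfl
  exact absurd h (by decide)

/-- all vectors stored in the trie lie in `W` -/
def InT (W : Submodule ℂ (ℕ →₀ ℂ)) : Tr → Prop
  | Tr.e => True
  | Tr.l v => ev v ∈ W
  | Tr.n a b => InT W a ∧ InT W b

theorem InT.mono {W W' : Submodule ℂ (ℕ →₀ ℂ)} (h : W ≤ W') : ∀ {t : Tr}, InT W t → InT W' t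
  | Tr.e, _ => trivial
  | Tr.l _, ht => h ht
  | Tr.n _ _, ht => ⟨InT.mono h ht.1, InT.mono h ht.2⟩

theorem look_mem {W : Submodule ℂ (ℕ →₀ ℂ)} (path : List ℕ) (k : ℕ) :
    ∀ t : Tr, InT W t → ev (look path k t) ∈ W := by
  induction path with
  | nil =>
    intro t ht
    rcases t with _ | v | ⟨a, b⟩
    · exact W.zero_mem
    · exact ht
    · exact W.zero_mem
  | cons b path ih =>
    intro t ht
    rcases t with _ | v | ⟨t0, t1⟩
    · exact W.zero_mem
    · exact W.zero_mem
    · change ev (Nat.rec (motive := fun _ => Vec) (look path k t0) (fun _ _ => look path k t1)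
        (Nat.land k b)) ∈ W
      cases Nat.land k b with
      | zero => exact ih _ ht.1
      | succ m => exact ih _ ht.2

theorem snode0_eq (a b : Tr) : snode0 a b = Tr.n a b := by cases a <;> rfl
theorem snode1_eq (a b : Tr) : snode1 a b = Tr.n a b := by cases b <;> rfl

theorem ins_in {W : Submodule ℂ (ℕ →₀ ℂ)} (path : List ℕ) (k : ℕ) (v : Vec) (hv : ev v ∈ W) :
    ∀ t : Tr, InT W t → InT W (ins path k v t) := by
  induction path with
  | nil => intro t _; exact hv
  | cons b path ih =>
    have key : ∀ t0 t1 : Tr, InT W t0 → InT W t1 → InT W (ins1 (ins path k v) k b t0 t1) := by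
      intro t0 t1 h0 h1
      unfold ins1
      cases Nat.land k b with
      | zero =>
        change InT W (snode0 _ _)
        rw [snode0_eq]; exact ⟨ih _ h0, h1⟩
      | succ m =>
        change InT W (snode1 _ _)
        rw [snode1_eq]; exact ⟨h0, ih _ h1⟩
    intro t ht
    rcases t with _ | v | ⟨t0, t1⟩
    · exact key _ _ trivial trivial
    · exact ht
    · exact key _ _ ht.1 ht.2

theorem ev_red1 (x q : Vec) (c d : ℤ) :
    ∃ s μ : ℂ, s ≠ 0 ∧ ev (red1 x q c d) = s • ev x + μ • ev q := by
  unfold red1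
  cases isz (Int.sub c d) with
  | true =>
    refine ⟨1, -1, one_ne_zero, ?_⟩
    change ev (mrg Int.sub Int.neg 1000 x q) = _
    rw [ev_mrg Int.sub Int.neg (-1), one_smul]
    · intro c; change ((-c : ℤ) : ℂ) = _; push_cast; ring
    · intro c c'; change ((c - c' : ℤ) : ℂ) = _; push_cast; ring
  | false =>
    cases isz (Int.add c d) with
    | true =>
      refine ⟨1, 1, one_ne_zero, ?_⟩
      change ev (mrg Int.add (fun v => v) 1000 x q) = _
      rw [ev_mrg Int.add (fun v => v) 1, one_smul, one_smul]
      · intro c; ring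
      · intro c c'; change ((c + c' : ℤ) : ℂ) = _; push_cast; ring
    | false =>
      change ∃ s μ : ℂ, s ≠ 0 ∧ ev (redGen2 x q (d / Int.gcd c d) (c / Int.gcd c d)) = _
      generalize d / (Int.gcd c d : ℤ) = s
      generalize c / (Int.gcd c d : ℤ) = m
      unfold redGen2
      cases h : isz s with
      | true => exact ⟨1, 0, one_ne_zero, by simp⟩
      | false =>
        refine ⟨s, -m, by exact_mod_cast isz_false h, ?_⟩
        change ev (mrg (fun u v => Int.sub u (Int.mul m v)) (fun v => Int.neg (Int.mul m v)) 1000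
          (mapV (fun u => Int.mul s u) x) q) = _
        rw [ev_mrg _ _ (-(m : ℂ)), ev_mapV _ (s : ℂ)]
        · intro c; change ((s * c : ℤ) : ℂ) = _; push_cast; ring
        · intro c; change ((-(m * c) : ℤ) : ℂ) = _; push_cast; ring
        · intro c c'; change ((c - m * c' : ℤ) : ℂ) = _; push_cast; ring

theorem ev_reduce {W : Submodule ℂ (ℕ →₀ ℂ)} (path : List ℕ) (t : Tr) (ht : InT W t) (n : ℕ) :
    ∀ x : Vec, ∃ s : ℂ, s ≠ 0 ∧ ∃ w ∈ W, ev (reduce path t n x) = s • ev x + w := by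
  induction n with
  | zero => intro x; exact ⟨1, one_ne_zero, 0, W.zero_mem, by simp [reduce]⟩
  | succ n ih =>
    intro x
    rcases x with _ | ⟨k, c, x'⟩
    · exact ⟨1, one_ne_zero, 0, W.zero_mem, by simp [reduce, ev]⟩
    change ∃ s : ℂ, s ≠ 0 ∧ ∃ w ∈ W,
      ev (reduce2 (reduce path t n) (Vec.cons k c x') c (look path k t)) = _
    have hq := look_mem path k t ht
    generalize look path k t = q at hq
    generalize Vec.cons k c x' = x
    rcases hq' : q with _ | ⟨k', d, q'⟩
    · exact ⟨1, one_ne_zero, 0, W.zero_mem, by simp [reduce2]⟩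
    rw [← hq']
    have : reduce2 (reduce path t n) x c q = reduce path t n (red1 x q c d) := by
      subst hq'; rfl
    rw [this]
    obtain ⟨s, μ, hs, h1⟩ := ev_red1 x q c d
    obtain ⟨s', hs', w, hw, h2⟩ := ih (red1 x q c d)
    refine ⟨s' * s, mul_ne_zero hs' hs, s' • μ • ev q + w,
      W.add_mem (W.smul_mem _ (W.smul_mem _ hq)) hw, ?_⟩
    rw [h2, h1, smul_add, mul_smul, add_assoc]

theorem forceT_eq (f : Tr → ℕ → Tr × ℕ) (n : ℕ) (t : Tr) : forceT f n t = f t n := by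
  cases t <;> rfl

theorem finrank_sup_span_le {W : Submodule ℂ (ℕ →₀ ℂ)} [FiniteDimensional ℂ W] (x : ℕ →₀ ℂ) :
    Module.finrank ℂ ↥(W ⊔ Submodule.span ℂ {x}) ≤ Module.finrank ℂ W + 1 := by
  refine (Submodule.finrank_add_le_finrank_add_finrank _ _).trans ?_
  have := finrank_span_le_card (R := ℂ) ({x} : Set (ℕ →₀ ℂ))
  simp at this
  omega

theorem rows_spec (path : List ℕ) (rows : List Vec) :
    ∀ (t : Tr) (n : ℕ) (W : Submodule ℂ (ℕ →₀ ℂ)), FiniteDimensional ℂ W → InT W t →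
      Module.finrank ℂ W ≤ n →
      InT (W ⊔ Submodule.span ℂ {y | ∃ x ∈ rows, ev x = y}) (run path rows t n).1 ∧
      Module.finrank ℂ ↥(W ⊔ Submodule.span ℂ {y | ∃ x ∈ rows, ev x = y})
        ≤ (run path rows t n).2 := by
  induction rows with
  | nil =>
    intro t n W _ ht hn
    have : W ⊔ Submodule.span ℂ {y | ∃ x ∈ ([] : List Vec), ev x = y} = W := by simp
    rw [this]; exact ⟨ht, hn⟩
  | cons x rows ih =>
    intro t n W hW ht hn
    have hsplit : W ⊔ Submodule.span ℂ {y | ∃ x' ∈ x :: rows, ev x' = y} =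
        (W ⊔ Submodule.span ℂ {ev x}) ⊔ Submodule.span ℂ {y | ∃ x ∈ rows, ev x = y} := by
      rw [sup_assoc, ← Submodule.span_union]
      congr 2
      ext y; simp [eq_comm]
    rw [hsplit]
    have hrun : run path (x :: rows) t n = step path (run path rows) t n (reduce path t 1000 x) :=
      rfl
    rw [hrun]
    obtain ⟨s, hs, w, hw, h⟩ := ev_reduce path t ht 1000 x
    generalize reduce path t 1000 x = r at h
    rcases hr : r with _ | ⟨k, c, r'⟩
    · have hx : ev x ∈ W := by
        rw [hr, ev_nil] at h
        have : s • ev x ∈ W := by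
          rw [← neg_eq_of_add_eq_zero_left h.symm]; exact W.neg_mem hw
        exact (W.smul_mem_iff hs).1 this
      have : W ⊔ Submodule.span ℂ {ev x} = W := by
        rw [sup_eq_left, Submodule.span_singleton_le_iff_mem]; exact hx
      rw [this]
      exact ih t n W hW ht hn
    · have e : step path (run path rows) t n (Vec.cons k c r') =
          run path rows (ins path k (Vec.cons k c r') t) (n + 1) := forceT_eq _ _ _
      rw [e, ← hr]
      have hle : W ≤ W ⊔ Submodule.span ℂ {ev x} := le_sup_left
      refine ih _ _ _ inferInstance (ins_in _ _ _ ?_ _ (ht.mono hle)) ?_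
      · rw [h]
        exact Submodule.add_mem _ (Submodule.smul_mem _ _
          (Submodule.mem_sup_right (Submodule.mem_span_singleton_self _))) (hle hw)
      · exact (finrank_sup_span_le _).trans (Nat.succ_le_succ hn)

theorem flat_mem {W : Submodule ℂ (ℕ →₀ ℂ)} (t : Tr) : ∀ acc : List Vec, InT W t →
    (∀ v ∈ acc, ev v ∈ W) → ∀ v ∈ flat t acc, ev v ∈ W := by
  induction t with
  | e => intro acc _ h; exact h
  | l v =>
    intro acc ht h w hw
    rcases List.mem_cons.1 (show w ∈ v :: acc from hw) with rfl | hw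
    · exact ht
    · exact h _ hw
  | n a b iha ihb =>
    intro acc ht h
    exact ihb (flat a acc) ht.2 (iha acc ht.1 h)

theorem band_true {a b : Bool} (h : band a b = true) : a = true ∧ b = true := by
  cases a
  · exact absurd h (by simp [band])
  · exact ⟨rfl, h⟩

/-- vectors supported in degrees below `b` -/
def below (b : ℕ) : Submodule ℂ (ℕ →₀ ℂ) := Finsupp.supported ℂ ℂ (Set.Iio b)

theorem below_mono {a b : ℕ} (h : a ≤ b) : below a ≤ below b :=
  Finsupp.supported_mono (Set.Iio_subset_Iio h)

theorem desc_below (x : Vec) : ∀ b, desc x b = true → ev x ∈ below b := by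
  induction x with
  | nil => intro b _; exact Submodule.zero_mem _
  | cons k c t ih =>
    intro b h
    obtain ⟨h1, h2⟩ := band_true (show band (Nat.ble (Nat.succ k) b) (desc t k) = true from h)
    have hk : k < b := Nat.le_of_ble_eq_true h1
    rw [ev_cons]
    exact Submodule.add_mem _ (Finsupp.single_mem_supported ℂ _ hk)
      (below_mono hk.le (ih k h2))

theorem chkL_spec (r : ℕ) (l : List Vec) : ∀ b n, chkL r l b n = true →
    (∀ v ∈ l, ev v ∈ below b) ∧
    r ≤ n + Module.finrank ℂ ↥(Submodule.span ℂ {y | ∃ x ∈ l, ev x = y}) := by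
  induction l with
  | nil =>
    intro b n h
    have : n = r := Nat.eq_of_beq_eq_true h
    subst this
    exact ⟨by simp, by omega⟩
  | cons v l ih =>
    intro b n h
    rcases v with _ | ⟨k, c, t⟩
    · exact absurd (show false = true from h) (by simp)
    obtain ⟨h1, h⟩ := band_true (show band (Nat.ble (Nat.succ k) b) (band (not (isz c))
      (band (desc t k) (chkL r l k (Nat.succ n)))) = true from h)
    obtain ⟨h2, h⟩ := band_true h
    obtain ⟨h3, h4⟩ := band_true h
    have hk : k < b := Nat.le_of_ble_eq_true h1
    have hc : c ≠ 0 := isz_false (by simpa using h2)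
    obtain ⟨i1, i2⟩ := ih k (n + 1) h4
    have ht := desc_below t k h3
    constructor
    · intro w hw
      rcases List.mem_cons.1 hw with rfl | hw
      · rw [ev_cons]
        exact Submodule.add_mem _ (Finsupp.single_mem_supported ℂ _ hk) (below_mono hk.le ht)
      · exact below_mono hk.le (i1 _ hw)
    · have hfin : FiniteDimensional ℂ
          ↥(Submodule.span ℂ {y | ∃ x ∈ Vec.cons k c t :: l, ev x = y}) := by
        apply FiniteDimensional.span_of_finite
        exact ((Vec.cons k c t :: l).finite_toSet).image ev
      have hlt : Submodule.span ℂ {y | ∃ x ∈ l, ev x = y} <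
          Submodule.span ℂ {y | ∃ x ∈ Vec.cons k c t :: l, ev x = y} := by
        refine lt_of_le_of_ne (Submodule.span_mono ?_) ?_
        · rintro y ⟨x, hx, rfl⟩
          exact ⟨x, List.mem_cons_of_mem _ hx, rfl⟩
        · intro heq
          have hmem : ev (Vec.cons k c t) ∈ Submodule.span ℂ {y | ∃ x ∈ l, ev x = y} := by
            rw [heq]; exact Submodule.subset_span ⟨_, List.mem_cons_self, rfl⟩
          have hle : Submodule.span ℂ {y | ∃ x ∈ l, ev x = y} ≤ below k := by
            rw [Submodule.span_le]
            rintro y ⟨x, hx, rfl⟩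
            exact i1 x hx
          have h5 := (Submodule.add_mem_iff_left _ ht).1 (ev_cons k c t ▸ hle hmem)
          have h6 := (Finsupp.mem_supported' ℂ _).1 h5 k (by simp)
          simp at h6
          exact hc h6
      have := Submodule.finrank_lt_finrank_of_lt hlt
      omega

theorem chk_spec {p r : ℕ} (h : chk p r = true) :
    Module.finrank ℂ ↥(Submodule.span ℂ {y | ∃ x ∈ rows p, ev x = y}) = r := by
  have hb : FiniteDimensional ℂ (⊥ : Submodule ℂ (ℕ →₀ ℂ)) := inferInstance
  obtain ⟨h1, h2⟩ := rows_spec path (rows p) Tr.e 0 ⊥ hb trivial (by simp)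
  rw [bot_sup_eq] at h1 h2
  unfold chk at h
  generalize run path (rows p) Tr.e 0 = s at h h1 h2
  obtain ⟨t, n⟩ := s
  obtain ⟨h3, h4⟩ := band_true (show band (Nat.beq n r) (chkL r (flat t []) 1000000 0) = true from h)
  have hn : n = r := Nat.eq_of_beq_eq_true h3
  have h5 := flat_mem t [] h1 (by simp)
  obtain ⟨_, h6⟩ := chkL_spec r _ _ _ h4
  have hfin : FiniteDimensional ℂ ↥(Submodule.span ℂ {y | ∃ x ∈ rows p, ev x = y}) := by
    apply FiniteDimensional.span_of_finite
    exact ((rows p).finite_toSet).image ev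
  have h7 : Submodule.span ℂ {y | ∃ x ∈ flat t [], ev x = y} ≤
      Submodule.span ℂ {y | ∃ x ∈ rows p, ev x = y} := by
    rw [Submodule.span_le]
    rintro y ⟨x, hx, rfl⟩
    exact h5 x hx
  have h8 := Submodule.finrank_mono h7
  simp only at h2
  omega

/-! ### The explicit Koszul complexes -/

abbrev Ex := Fin 3 →₀ ℕ
abbrev XX := (Finset (Fin 15) × Ex) →₀ ℂ

/-- exponents of the fifteen monomials of degree four, the three pure powers first -/
def mc : Fin 15 → Fin 3 → ℕ :=
  ![![4, 0, 0], ![0, 4, 0], ![0, 0, 4], ![1, 1, 2], ![3, 1, 0], ![2, 1, 1], ![1, 3, 0],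
    ![0, 3, 1], ![1, 2, 1], ![0, 2, 2], ![0, 1, 3], ![1, 0, 3], ![2, 0, 2], ![3, 0, 1],
    ![2, 2, 0]]

def mon (t : Fin 15) : Ex := Finsupp.equivFunOnFinite.symm (mc t)

theorem mon_apply (t : Fin 15) (i : Fin 3) : mon t i = mc t i := rfl

theorem mon_degree (t : Fin 15) : (mon t).degree = 4 := by
  rw [Finsupp.degree_eq_sum]
  simp only [mon_apply]
  revert t; decide

def cls (k : ℕ) (f : Ex) : Prop := ∀ i : Fin 3, i.val < k → f i < 4

instance (k : ℕ) (f : Ex) : Decidable (cls k f) := by unfold cls; infer_instance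

def cnt (T : Finset (Fin 15)) (t : Fin 15) : ℕ := (T.filter (· < t)).card
def sgn (T : Finset (Fin 15)) (t : Fin 15) : ℂ := (-1) ^ (cnt T t + 1)

def ddb (k : ℕ) (a : Finset (Fin 15) × Ex) : XX :=
  ∑ t ∈ a.1, if cls k (mon t + a.2) then Finsupp.single (a.1.erase t, mon t + a.2) (sgn a.1 t)
    else 0

/-- the differential, where all terms not satisfying `cls k` are dropped -/
def dd (k : ℕ) : XX →ₗ[ℂ] XX := Finsupp.linearCombination ℂ (ddb k)

theorem dd_single (k : ℕ) (a) (c : ℂ) : dd k (Finsupp.single a c) = c • ddb k a :=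
  Finsupp.linearCombination_single _ _ _

def AA (k p : ℕ) (e : ℤ) : Set (Finset (Fin 15) × Ex) :=
  {a | (∀ t ∈ a.1, k ≤ t.val) ∧ a.1.card = p ∧ cls k a.2 ∧ (a.2.degree : ℤ) = e}

def Pc (k p : ℕ) (e : ℤ) : Submodule ℂ XX := Finsupp.supported ℂ ℂ (AA k p e)

def hdim (k p : ℕ) (e : ℤ) : ℕ :=
  Module.finrank ℂ ↥(LinearMap.ker (dd k) ⊓ Pc k p e) -
    Module.finrank ℂ ↥((Pc k (p + 1) (e - 4)).map (dd k))

theorem AA_finite (k p : ℕ) (e : ℤ) : (AA k p e).Finite := by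
  have h : ({f : Ex | f.degree ≤ e.toNat} : Set Ex).Finite := Finsupp.finite_of_degree_le _
  refine ((Set.finite_univ (α := Finset (Fin 15))).prod h).subset ?_
  rintro ⟨T, f⟩ ⟨_, _, _, h⟩
  refine ⟨Set.mem_univ _, ?_⟩
  change f.degree ≤ e.toNat
  change (f.degree : ℤ) = e at h
  omega

instance (k p : ℕ) (e : ℤ) : FiniteDimensional ℂ (Pc k p e) := by
  have := (AA_finite k p e).to_subtype
  exact Module.Finite.equiv (Finsupp.supportedEquivFinsupp (R := ℂ) (M := ℂ) (AA k p e)).symm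

theorem finrank_Pc (k p : ℕ) (e : ℤ) : Module.finrank ℂ (Pc k p e) = (AA k p e).ncard := by
  have := (AA_finite k p e).fintype
  rw [Set.ncard_eq_toFinset_card', Set.toFinset_card]
  have h := LinearEquiv.finrank_eq (Finsupp.supportedEquivFinsupp (R := ℂ) (M := ℂ) (AA k p e))
  rw [Module.finrank_finsupp_self] at h
  exact h

theorem cls_mono {k : ℕ} {f g : Ex} (h : cls k (g + f)) : cls k f := by
  intro i hi
  have := h i hi
  rw [Finsupp.add_apply] at this
  omega

/-- to show a submodule statement on `Pc` it is enough to look at basis vectors -/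
theorem Pc_le_iff {k p : ℕ} {e : ℤ} {W : Submodule ℂ XX} :
    Pc k p e ≤ W ↔ ∀ a ∈ AA k p e, Finsupp.single a (1 : ℂ) ∈ W := by
  unfold Pc
  rw [Finsupp.supported_eq_span_single, Submodule.span_le]
  constructor
  · intro h a ha; exact h ⟨a, ha, rfl⟩
  · rintro h _ ⟨a, ha, rfl⟩; exact h a ha

theorem single_mem_Pc {k p : ℕ} {e : ℤ} {a} (h : a ∈ AA k p e) (c : ℂ) :
    Finsupp.single a c ∈ Pc k p e := Finsupp.single_mem_supported ℂ _ h

theorem dd_mem {k p : ℕ} {e : ℤ} {x : XX} (hx : x ∈ Pc k (p + 1) e) : dd k x ∈ Pc k p (e + 4) := by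
  suffices Pc k (p + 1) e ≤ (Pc k p (e + 4)).comap (dd k) from this hx
  rw [Pc_le_iff]
  rintro ⟨T, f⟩ ⟨h1, h2, h3, h4⟩
  rw [Submodule.mem_comap, dd_single, one_smul]
  refine Submodule.sum_mem _ fun t ht => ?_
  split_ifs with hc
  · refine single_mem_Pc ⟨fun s hs => h1 s (Finset.mem_of_mem_erase hs), ?_, hc, ?_⟩ _
    · change (T.erase t).card = p
      rw [Finset.card_erase_of_mem (show t ∈ T from ht)]
      change T.card = p + 1 at h2
      omega
    · change ((mon t + f).degree : ℤ) = e + 4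
      change (f.degree : ℤ) = e at h4
      rw [map_add, mon_degree]; push_cast; omega
  · exact Submodule.zero_mem _

theorem dd_zero {k : ℕ} {e : ℤ} {x : XX} (hx : x ∈ Pc k 0 e) : dd k x = 0 := by
  suffices Pc k 0 e ≤ LinearMap.ker (dd k) from this hx
  rw [Pc_le_iff]
  rintro ⟨T, f⟩ ⟨h1, h2, h3, h4⟩
  have : T = ∅ := Finset.card_eq_zero.1 h2
  subst this
  rw [LinearMap.mem_ker, dd_single]
  simp [ddb]

theorem cnt_erase_of_lt {T : Finset (Fin 15)} {s t : Fin 15} (h : s < t) :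
    cnt (T.erase t) s = cnt T s := by
  unfold cnt
  congr 1
  ext u; simp only [Finset.mem_filter, Finset.mem_erase]
  constructor
  · rintro ⟨⟨_, h1⟩, h2⟩; exact ⟨h1, h2⟩
  · rintro ⟨h1, h2⟩; exact ⟨⟨(h2.trans h).ne, h1⟩, h2⟩

theorem cnt_erase_of_gt {T : Finset (Fin 15)} {s t : Fin 15} (hs : s ∈ T) (h : s < t) :
    cnt (T.erase s) t + 1 = cnt T t := by
  unfold cnt
  have : (T.erase s).filter (· < t) = (T.filter (· < t)).erase s := by
    ext u; simp only [Finset.mem_filter, Finset.mem_erase]; tauto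
  rw [this, Finset.card_erase_add_one]
  simp [hs, h]

theorem sgn_swap {T : Finset (Fin 15)} {s t : Fin 15} (hs : s ∈ T) (ht : t ∈ T) (h : s ≠ t) :
    sgn T t * sgn (T.erase t) s = - (sgn T s * sgn (T.erase s) t) := by
  have key : ∀ s t : Fin 15, s ∈ T → s < t →
      sgn T t * sgn (T.erase t) s = - (sgn T s * sgn (T.erase s) t) := by
    intro s t hs h
    unfold sgn
    rw [cnt_erase_of_lt h, ← cnt_erase_of_gt hs h]
    ring
  rcases lt_or_gt_of_ne h with h | h
  · exact key s t hs h
  · rw [key t s ht h, neg_neg]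

theorem dd_dd (k : ℕ) (x : XX) : dd k (dd k x) = 0 := by
  suffices h : (dd k).comp (dd k) = 0 from LinearMap.congr_fun h x
  ext1 a
  ext1
  simp only [LinearMap.comp_apply, Finsupp.lsingle_apply, LinearMap.zero_comp,
    LinearMap.zero_apply]
  rw [dd_single, one_smul]
  obtain ⟨T, f⟩ := a
  have h1 : dd k (ddb k (T, f)) = ∑ t ∈ T, ∑ s ∈ T.erase t,
      if cls k (mon s + (mon t + f)) then
        Finsupp.single ((T.erase t).erase s, mon s + (mon t + f)) (sgn T t * sgn (T.erase t) s)
      else 0 := by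
    unfold ddb
    rw [map_sum]
    refine Finset.sum_congr rfl fun t _ => ?_
    simp only
    split_ifs with hc
    · rw [dd_single, ddb, Finset.smul_sum]
      refine Finset.sum_congr rfl fun s _ => ?_
      simp only [smul_ite, smul_zero, Finsupp.smul_single, smul_eq_mul]
    · rw [map_zero]
      symm
      refine Finset.sum_eq_zero fun s _ => ?_
      rw [if_neg]
      exact fun h => hc (cls_mono h)
  rw [h1, Finset.sum_sigma']
  refine Finset.sum_involution (fun x _ => ⟨x.2, x.1⟩) ?_ ?_ ?_ ?_
  · rintro ⟨t, s⟩ hx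
    simp only [Finset.mem_sigma, Finset.mem_erase] at hx
    obtain ⟨ht, hst, hs⟩ := hx
    have e1 : mon t + (mon s + f) = mon s + (mon t + f) := by abel
    simp only [e1]
    split_ifs with hc
    · rw [Finset.erase_right_comm, sgn_swap hs ht hst, ← Finsupp.single_add]
      simp
    · simp
  · rintro ⟨t, s⟩ hx _ h
    simp only [Finset.mem_sigma, Finset.mem_erase] at hx
    simp only [Sigma.mk.injEq, heq_eq_eq] at h
    exact hx.2.1 h.1
  · rintro ⟨t, s⟩ hx
    simp only [Finset.mem_sigma, Finset.mem_erase] at hx ⊢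
    exact ⟨hx.2.2, hx.2.1.symm, hx.1⟩
  · rintro ⟨t, s⟩ hx; rfl

def kk (k : Fin 3) : Fin 15 := Fin.castLE (by decide) k

theorem mon_kk (k : Fin 3) : mon (kk k) = Finsupp.single k 4 := by
  ext i
  rw [mon_apply, Finsupp.single_apply]
  revert k i; decide

theorem cls_succ {k : Fin 3} {f : Ex} : cls (k.val + 1) f ↔ cls k.val f ∧ f k < 4 := by
  constructor
  · intro h; exact ⟨fun i hi => h i (by omega), h k (by omega)⟩
  · rintro ⟨h1, h2⟩ i hi
    rcases Nat.lt_succ_iff_lt_or_eq.1 hi with h | h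
    · exact h1 i h
    · rw [Fin.ext h]; exact h2

def good (k : Fin 3) (a : Finset (Fin 15) × Ex) : Prop := kk k ∉ a.1 ∧ a.2 k < 4
instance (k : Fin 3) : DecidablePred (good k) := fun a => by unfold good; infer_instance

def ppb (k : Fin 3) (a : Finset (Fin 15) × Ex) : XX :=
  if good k a then Finsupp.single a 1 else 0
def pp (k : Fin 3) : XX →ₗ[ℂ] XX := Finsupp.linearCombination ℂ (ppb k)
theorem pp_single (k : Fin 3) (a) (c : ℂ) :
    pp k (Finsupp.single a c) = if good k a then Finsupp.single a c else 0 := by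
  unfold pp ppb
  rw [Finsupp.linearCombination_single]
  split_ifs <;> simp

theorem pp_eq (k : Fin 3) (x : XX) : pp k x = x.filter (good k) := by
  induction x using Finsupp.induction_linear with
  | zero => rw [map_zero, Finsupp.filter_zero]
  | add f g hf hg => rw [map_add, hf, hg, Finsupp.filter_add]
  | single a c =>
    rw [pp_single]
    split_ifs with h
    · rw [Finsupp.filter_single_of_pos _ h]
    · rw [Finsupp.filter_single_of_neg _ h]

def hhb (k : Fin 3) (a : Finset (Fin 15) × Ex) : XX :=
  if kk k ∉ a.1 ∧ 4 ≤ a.2 k then Finsupp.single (insert (kk k) a.1, a.2 - Finsupp.single k 4) 1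
  else 0
def hh (k : Fin 3) : XX →ₗ[ℂ] XX := Finsupp.linearCombination ℂ (hhb k)
theorem hh_single (k : Fin 3) (a) (c : ℂ) :
    hh k (Finsupp.single a c) = if kk k ∉ a.1 ∧ 4 ≤ a.2 k then
      Finsupp.single (insert (kk k) a.1, a.2 - Finsupp.single k 4) c else 0 := by
  unfold hh hhb
  rw [Finsupp.linearCombination_single]
  split_ifs <;> simp

theorem pp_dd (k : Fin 3) (x : XX) : pp k (dd k.val x) = dd (k.val + 1) (pp k x) := by
  suffices h : (pp k).comp (dd k.val) = (dd (k.val + 1)).comp (pp k) from LinearMap.congr_fun h x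
  ext1 ⟨T, f⟩
  ext1
  simp only [LinearMap.comp_apply, Finsupp.lsingle_apply]
  rw [dd_single, one_smul, pp_single]
  have h1 : pp k (ddb k (T, f)) = ∑ t ∈ T, if cls k (mon t + f) ∧ good k (T.erase t, mon t + f) then
      Finsupp.single (T.erase t, mon t + f) (sgn T t) else 0 := by
    unfold ddb
    rw [map_sum]
    refine Finset.sum_congr rfl fun t _ => ?_
    simp only
    by_cases hc : cls k (mon t + f)
    · simp only [hc, true_and, if_true]; rw [pp_single]
    · simp [hc]
  rw [h1]
  by_cases hg : good k (T, f)
  · rw [if_pos hg, dd_single, one_smul, ddb]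
    refine Finset.sum_congr rfl fun t _ => ?_
    congr 1
    rw [cls_succ]
    simp only [good, eq_iff_iff]
    have := hg.1
    simp only at this
    simp [this]
  · rw [if_neg hg, map_zero]
    refine Finset.sum_eq_zero fun t ht => ?_
    rw [if_neg]
    rintro ⟨_, h2, h3⟩
    simp only [Finset.mem_erase, not_and_or, not_not] at h2
    simp only [Finsupp.add_apply] at h3
    rcases h2 with h2 | h2
    · subst h2
      rw [mon_kk, Finsupp.single_eq_same] at h3
      omega
    · exact hg ⟨h2, by simp only; omega⟩

theorem pp_hh (k : Fin 3) (x : XX) : pp k (hh k x) = 0 := by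
  suffices h : (pp k).comp (hh k) = 0 from LinearMap.congr_fun h x
  ext1 ⟨T, f⟩
  ext1
  simp only [LinearMap.comp_apply, Finsupp.lsingle_apply, LinearMap.zero_comp,
    LinearMap.zero_apply]
  rw [hh_single]
  split_ifs with h
  · rw [pp_single, if_neg]
    rintro ⟨h1, _⟩
    exact h1 (Finset.mem_insert_self _ _)
  · rw [map_zero]

theorem AA_succ_iff {k : Fin 3} {p : ℕ} {e : ℤ} {a} :
    a ∈ AA (k.val + 1) p e ↔ a ∈ AA k.val p e ∧ good k a := by
  obtain ⟨T, f⟩ := a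
  simp only [AA, Set.mem_ofPred_eq, cls_succ, good]
  constructor
  · rintro ⟨h1, h2, ⟨h3, h4⟩, h5⟩
    refine ⟨⟨fun t ht => (Nat.le_succ _).trans (h1 t ht), h2, h3, h5⟩, fun h => ?_, h4⟩
    have := h1 _ h
    simp [kk] at this
  · rintro ⟨⟨h1, h2, h3, h4⟩, h5, h6⟩
    refine ⟨fun t ht => ?_, h2, ⟨h3, h6⟩, h4⟩
    refine Nat.succ_le_of_lt (lt_of_le_of_ne (h1 t ht) fun h => h5 ?_)
    have : kk k = t := Fin.ext (by simpa [kk] using h)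
    rw [this]; exact ht

theorem Pc_succ_le (k : Fin 3) (p : ℕ) (e : ℤ) : Pc (k.val + 1) p e ≤ Pc k.val p e :=
  Finsupp.supported_mono fun _ h => (AA_succ_iff.1 h).1

theorem pp_mem {k : Fin 3} {p : ℕ} {e : ℤ} {x : XX} (hx : x ∈ Pc k.val p e) :
    pp k x ∈ Pc (k.val + 1) p e := by
  suffices Pc k.val p e ≤ (Pc (k.val + 1) p e).comap (pp k) from this hx
  rw [Pc_le_iff]
  intro a ha
  rw [Submodule.mem_comap, pp_single]
  split_ifs with h
  · exact single_mem_Pc (AA_succ_iff.2 ⟨ha, h⟩) _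
  · exact Submodule.zero_mem _

theorem pp_id {k : Fin 3} {p : ℕ} {e : ℤ} {x : XX} (hx : x ∈ Pc (k.val + 1) p e) :
    pp k x = x := by
  suffices Pc (k.val + 1) p e ≤ LinearMap.eqLocus (pp k) LinearMap.id from this hx
  rw [Pc_le_iff]
  intro a ha
  rw [LinearMap.mem_eqLocus, pp_single, if_pos (AA_succ_iff.1 ha).2]
  rfl

theorem hh_mem {k : Fin 3} {p : ℕ} {e : ℤ} {x : XX} (hx : x ∈ Pc k.val p e) :
    hh k x ∈ Pc k.val (p + 1) (e - 4) := by
  suffices Pc k.val p e ≤ (Pc k.val (p + 1) (e - 4)).comap (hh k) from this hx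
  rw [Pc_le_iff]
  rintro ⟨T, f⟩ ⟨h1, h2, h3, h4⟩
  rw [Submodule.mem_comap, hh_single]
  simp only at h1 h2 h3 h4 ⊢
  split_ifs with h
  · refine single_mem_Pc ⟨?_, ?_, ?_, ?_⟩ _
    · intro t ht
      rcases Finset.mem_insert.1 ht with rfl | ht
      · simp [kk]
      · exact h1 t ht
    · simp only
      rw [Finset.card_insert_of_notMem h.1, h2]
    · intro i hi
      have := h3 i hi
      simp only [Finsupp.coe_tsub, Pi.sub_apply]
      omega
    · have hle : Finsupp.single k 4 ≤ f := by
        rw [Finsupp.single_le_iff]; exact h.2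
      have e1 : (f - Finsupp.single k 4).degree + 4 = f.degree := by
        conv_rhs => rw [← tsub_add_cancel_of_le hle]
        rw [map_add, Finsupp.degree_single]
      simp only
      omega
  · exact Submodule.zero_mem _

theorem cnt_kk {k : Fin 3} {T : Finset (Fin 15)} (h : ∀ t ∈ T, k.val ≤ t.val) :
    cnt T (kk k) = 0 := by
  unfold cnt
  rw [Finset.card_eq_zero, Finset.filter_eq_empty_iff]
  intro t ht hlt
  have := h t ht
  have h2 : t.val < k.val := hlt
  omega

theorem cnt_insert {k : Fin 3} {T : Finset (Fin 15)} (h : ∀ t ∈ T, k.val ≤ t.val) (hk : kk k ∉ T)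
    {t : Fin 15} (ht : t ∈ T) : cnt (insert (kk k) T) t = cnt T t + 1 := by
  have hlt : kk k < t := by
    refine lt_of_le_of_ne ?_ (fun h' => hk (h' ▸ ht))
    exact h t ht
  rw [← cnt_erase_of_gt (Finset.mem_insert_self _ _) hlt, Finset.erase_insert hk]

/-- the contracting homotopy -/
theorem homotopy {k : Fin 3} {p : ℕ} {e : ℤ} {y : XX} (hy : y ∈ Pc k.val p e) (h0 : pp k y = 0) :
    dd k.val (hh k y) + hh k (dd k.val y) = - y := by
  have hy' : y ∈ Finsupp.supported ℂ ℂ (AA k.val p e ∩ {a | ¬ good k a}) := by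
    rw [Finsupp.supported_inter]
    refine ⟨hy, ?_⟩
    rw [SetLike.mem_coe, Finsupp.mem_supported']
    intro a ha
    simp only [Set.mem_ofPred_eq, not_not] at ha
    rw [pp_eq] at h0
    have := DFunLike.congr_fun h0 a
    rwa [Finsupp.filter_apply_pos _ _ ha] at this
  suffices hs : Finsupp.supported ℂ ℂ (AA k.val p e ∩ {a | ¬ good k a}) ≤
      LinearMap.eqLocus ((dd k.val).comp (hh k) + (hh k).comp (dd k.val)) (-LinearMap.id) from hs hy'
  rw [Finsupp.supported_eq_span_single, Submodule.span_le]
  rintro _ ⟨⟨T, f⟩, ⟨⟨h1, h2, h3, h4⟩, hg⟩, rfl⟩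
  simp only at h1 h2 h3 h4
  rw [SetLike.mem_coe, LinearMap.mem_eqLocus]
  simp only [LinearMap.add_apply, LinearMap.comp_apply, LinearMap.neg_apply, LinearMap.id_apply]
  rw [dd_single, one_smul, hh_single]
  have e0 : hh k (ddb k.val (T, f)) = ∑ t ∈ T, if cls k.val (mon t + f) ∧
      (kk k ∉ T.erase t ∧ 4 ≤ (mon t + f) k) then
      Finsupp.single (insert (kk k) (T.erase t), mon t + f - Finsupp.single k 4) (sgn T t)
      else 0 := by
    unfold ddb
    rw [map_sum]
    refine Finset.sum_congr rfl fun t _ => ?_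
    simp only
    by_cases hc : cls k (mon t + f)
    · simp only [hc, true_and, if_true]; rw [hh_single]
    · simp [hc]
  rw [e0]
  have hclsk : ∀ g : Ex, cls k.val (g + mon (kk k)) ↔ cls k.val g := by
    intro g
    refine forall_congr' fun i => forall_congr' fun hi => ?_
    rw [mon_kk, Finsupp.add_apply, Finsupp.single_apply, if_neg, add_zero]
    rintro rfl; exact lt_irrefl _ hi
  by_cases hk : kk k ∈ T
  · rw [if_neg (fun h => h.1 hk), map_zero, zero_add, Finset.sum_eq_single (kk k)]
    · rw [if_pos]
      · rw [Finset.insert_erase hk, mon_kk, add_tsub_cancel_left, sgn, cnt_kk h1]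
        simp
      · refine ⟨?_, Finset.notMem_erase _ _, ?_⟩
        · rw [add_comm, hclsk]; exact h3
        · rw [mon_kk]; simp
    · intro t ht htk
      rw [if_neg]
      rintro ⟨_, h, _⟩
      exact h (Finset.mem_erase.2 ⟨htk.symm, hk⟩)
    · intro h; exact absurd hk h
  · have hf : 4 ≤ f k := by
      by_contra hf
      exact hg ⟨hk, by simpa using hf⟩
    rw [if_pos ⟨hk, hf⟩, dd_single, one_smul, ddb]
    have hle : Finsupp.single k 4 ≤ f := by
      rw [Finsupp.single_le_iff]; exact hf
    simp only
    rw [Finset.sum_insert hk, add_assoc]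
    have e1 : mon (kk k) + (f - Finsupp.single k 4) = f := by
      rw [mon_kk, add_comm, tsub_add_cancel_of_le hle]
    have hT : ∀ t ∈ insert (kk k) T, k.val ≤ t.val := by
      intro t ht
      rcases Finset.mem_insert.1 ht with rfl | ht
      · simp [kk]
      · exact h1 t ht
    rw [e1, if_pos h3, Finset.erase_insert hk, sgn, cnt_kk hT, ← Finset.sum_add_distrib,
      Finset.sum_eq_zero, add_zero]
    · simp
    · intro t ht
      have e2 : mon t + (f - Finsupp.single k 4) = mon t + f - Finsupp.single k 4 :=
        (add_tsub_assoc_of_le hle _).symm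
      have e3 : cls k.val (mon t + (f - Finsupp.single k 4)) ↔ cls k.val (mon t + f) := by
        rw [← hclsk, add_assoc, add_comm _ (mon (kk k)), e1]
      have htk : kk k ≠ t := fun h => hk (h ▸ ht)
      by_cases hc : cls k.val (mon t + f)
      · rw [if_pos (e3.2 hc), if_pos, e2, Finset.erase_insert_of_ne htk, ← Finsupp.single_add]
        · unfold sgn
          rw [cnt_insert h1 hk ht, pow_succ, mul_neg_one, neg_add_cancel, Finsupp.single_zero]
        · refine ⟨hc, fun h => hk (Finset.mem_of_mem_erase h), ?_⟩
          rw [Finsupp.add_apply]; omega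
      · rw [if_neg (fun h => hc (e3.1 h)), if_neg (fun h => hc h.1), add_zero]

theorem finrank_map_add {X Y : Type*} [AddCommGroup X] [Module ℂ X] [AddCommGroup Y] [Module ℂ Y]
    (g : X →ₗ[ℂ] Y) (Z : Submodule ℂ X) [FiniteDimensional ℂ Z] :
    Module.finrank ℂ ↥(Z.map g) + Module.finrank ℂ ↥(LinearMap.ker g ⊓ Z) = Module.finrank ℂ Z := by
  have h := LinearMap.finrank_range_add_finrank_ker (g.domRestrict Z)
  rw [LinearMap.range_domRestrict] at h
  have e : Module.finrank ℂ ↥(LinearMap.ker (g.domRestrict Z)) =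
      Module.finrank ℂ ↥(LinearMap.ker g ⊓ Z) := by
    have e' : (Z.subtype ∘ₗ (LinearMap.ker (g.domRestrict Z)).subtype).range =
        LinearMap.ker g ⊓ Z := by
      rw [LinearMap.range_comp, Submodule.range_subtype, LinearMap.ker_domRestrict,
        Submodule.map_comap_subtype, inf_comm]
    rw [← e', LinearMap.finrank_range_of_inj]
    exact Z.injective_subtype.comp (Submodule.injective_subtype _)
  rw [e] at h
  exact h

theorem abstract_hdim {X : Type*} [AddCommGroup X] [Module ℂ X] (π : X →ₗ[ℂ] X)
    (Z B Z' B' : Submodule ℂ X) [FiniteDimensional ℂ Z] [FiniteDimensional ℂ Z']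
    (hB : B ≤ Z) (hB' : B' ≤ Z') (hZ : Z.map π = Z') (h1 : ∀ b ∈ B, π b ∈ B')
    (h2 : ∀ z ∈ Z, π z ∈ B' → z ∈ B) :
    Module.finrank ℂ Z - Module.finrank ℂ B = Module.finrank ℂ Z' - Module.finrank ℂ B' := by
  have a1 := finrank_map_add (B'.mkQ.comp π) Z
  have a2 := finrank_map_add B'.mkQ Z'
  have e1 : LinearMap.ker (B'.mkQ.comp π) ⊓ Z = B := by
    ext z
    simp only [Submodule.mem_inf, LinearMap.mem_ker, LinearMap.comp_apply,
      Submodule.mkQ_apply, Submodule.Quotient.mk_eq_zero]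
    exact ⟨fun h => h2 z h.2 h.1, fun h => ⟨h1 z h, hB h⟩⟩
  have e2 : LinearMap.ker B'.mkQ ⊓ Z' = B' := by
    rw [Submodule.ker_mkQ, inf_eq_left]; exact hB'
  rw [e1, Submodule.map_comp, hZ] at a1
  rw [e2] at a2
  omega

theorem hdim_step (k : Fin 3) (p : ℕ) (e : ℤ) : hdim k.val p e = hdim (k.val + 1) p e := by
  unfold hdim
  have bnd : ∀ k, (Pc k (p + 1) (e - 4)).map (dd k) ≤ LinearMap.ker (dd k) ⊓ Pc k p e := by
    rintro k _ ⟨x, hx, rfl⟩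
    refine ⟨dd_dd k x, ?_⟩
    have := dd_mem hx
    rwa [sub_add_cancel] at this
  have fin : ∀ k, FiniteDimensional ℂ ↥(LinearMap.ker (dd k) ⊓ Pc k p e) := fun k =>
    Submodule.finiteDimensional_of_le inf_le_right
  have ddmem : ∀ z' ∈ Pc (k.val + 1) p e, ∃ e', hh k (dd k.val z') ∈ Pc k.val p e ∧
      ∃ p', dd k.val z' ∈ Pc k.val p' e' := by
    intro z' hz'
    have hz := Pc_succ_le k p e hz'
    rcases p with _ | p
    · refine ⟨e, ?_, 0, ?_⟩
      · rw [dd_zero hz, map_zero]; exact Submodule.zero_mem _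
      · rw [dd_zero hz]; exact Submodule.zero_mem _
    · refine ⟨e + 4, ?_, p, dd_mem hz⟩
      have := hh_mem (dd_mem hz)
      rwa [add_sub_cancel_right] at this
  have := fin k
  have := fin (k + 1)
  refine abstract_hdim (pp k) _ _ _ _ (bnd _) (bnd _) ?_ ?_ ?_
  · apply le_antisymm
    · rintro _ ⟨z, ⟨hz1, hz2⟩, rfl⟩
      refine ⟨?_, pp_mem hz2⟩
      rw [SetLike.mem_coe, LinearMap.mem_ker] at hz1 ⊢
      rw [← pp_dd, hz1, map_zero]
    · rintro z' ⟨hz1, hz2⟩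
      rw [SetLike.mem_coe, LinearMap.mem_ker] at hz1
      obtain ⟨e', m1, p', m2⟩ := ddmem z' hz2
      refine ⟨z' + hh k (dd k.val z'), ⟨?_, Submodule.add_mem _ (Pc_succ_le k p e hz2) m1⟩, ?_⟩
      · rw [SetLike.mem_coe, LinearMap.mem_ker, map_add]
        have hom := homotopy m2 (by rw [pp_dd, pp_id hz2, hz1])
        rw [dd_dd, map_zero, add_zero] at hom
        rw [hom, add_neg_cancel]
      · rw [map_add, pp_hh, add_zero, pp_id hz2]
  · rintro _ ⟨w, hw, rfl⟩
    exact ⟨pp k w, pp_mem hw, (pp_dd k w).symm⟩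
  · rintro z ⟨hz1, hz2⟩ ⟨w, hw, hwz⟩
    rw [SetLike.mem_coe, LinearMap.mem_ker] at hz1
    have hw' := Pc_succ_le k _ _ hw
    have hdw := dd_mem hw'
    rw [sub_add_cancel] at hdw
    have hom := homotopy (y := z - dd k.val w) (Submodule.sub_mem _ hz2 hdw)
      (by rw [map_sub, pp_dd, pp_id hw, hwz, sub_self])
    rw [map_sub (dd k.val), hz1, dd_dd, sub_self, map_zero, add_zero] at hom
    refine ⟨w - hh k (z - dd k.val w), Submodule.sub_mem _ hw'
      (hh_mem (Submodule.sub_mem _ hz2 hdw)), ?_⟩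
    rw [map_sub, hom]; abel

theorem hdim_zero_eq (p : ℕ) (e : ℤ) : hdim 0 p e = hdim 3 p e :=
  (hdim_step 0 p e).trans ((hdim_step 1 p e).trans (hdim_step 2 p e))

/-! ### The Artinian complex -/

def trip (x : ℕ × ℕ × ℕ) : Ex := Finsupp.equivFunOnFinite.symm ![x.1, x.2.1, x.2.2]

theorem trip_inj : Function.Injective trip := by
  rintro ⟨a, b, c⟩ ⟨a', b', c'⟩ h
  have h0 := DFunLike.congr_fun h 0
  have h1 := DFunLike.congr_fun h 1
  have h2 := DFunLike.congr_fun h 2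
  simp [trip] at h0 h1 h2
  simp [h0, h1, h2]

theorem degree3 (f : Ex) : f.degree = f 0 + f 1 + f 2 := by
  rw [Finsupp.degree_eq_sum, Fin.sum_univ_three]

def Fe (e : ℕ) : Finset (ℕ × ℕ × ℕ) :=
  (Finset.range 4 ×ˢ Finset.range 4 ×ˢ Finset.range 4).filter fun x => x.1 + x.2.1 + x.2.2 = e

def Hi : Finset (Fin 15) := Finset.univ.filter fun t => 3 ≤ t.val

theorem AA3_eq (p e : ℕ) : AA 3 p e =
    (fun x : Finset (Fin 15) × (ℕ × ℕ × ℕ) => (x.1, trip x.2)) ''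
      ((Finset.powersetCard p Hi ×ˢ Fe e : Finset _) : Set (Finset (Fin 15) × (ℕ × ℕ × ℕ))) := by
  ext ⟨T, f⟩
  simp only [AA, Set.mem_ofPred_eq, Set.mem_image, Finset.coe_product, Set.mem_prod,
    Finset.mem_coe, Finset.mem_powersetCard, Prod.mk.injEq, Prod.exists, Fe, Finset.mem_filter,
    Finset.mem_product, Finset.mem_range]
  constructor
  · rintro ⟨h1, h2, h3, h4⟩
    refine ⟨T, f 0, f 1, f 2, ⟨⟨fun t ht => ?_, h2⟩, ⟨h3 0 (by decide), h3 1 (by decide),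
      h3 2 (by decide)⟩, ?_⟩, rfl, ?_⟩
    · simp [Hi, h1 t ht]
    · rw [degree3] at h4; exact_mod_cast h4
    · ext i; fin_cases i <;> rfl
  · rintro ⟨T', a, b, c, ⟨⟨h1, h2⟩, ⟨ha, hb, hc⟩, h4⟩, rfl, rfl⟩
    refine ⟨fun t ht => ?_, h2, ?_, ?_⟩
    · have := h1 ht; simpa [Hi] using this
    · intro i _
      fin_cases i
      · exact ha
      · exact hb
      · exact hc
    · rw [degree3]
      exact_mod_cast h4

theorem AA3_ncard (p e : ℕ) : (AA 3 p e).ncard = Nat.choose 12 p * (Fe e).card := by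
  rw [AA3_eq, Set.ncard_image_of_injective, Set.ncard_coe_finset, Finset.card_product,
    Finset.card_powersetCard]
  · rfl
  · rintro ⟨T, x⟩ ⟨T', x'⟩ h
    simp only [Prod.mk.injEq] at h
    rw [h.1, trip_inj h.2]

theorem Pc3_bot {p : ℕ} {e : ℤ} (h : e < 0 ∨ 9 < e) : Pc 3 p e = ⊥ := by
  have : AA 3 p e = ∅ := by
    ext ⟨T, f⟩
    simp only [Set.mem_empty_iff_false, iff_false]
    rintro ⟨_, _, h3, h4⟩
    simp only [degree3] at h4
    have h0 := h3 0 (by decide)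
    have h1 := h3 1 (by decide)
    have h2 := h3 2 (by decide)
    simp only at h0 h1 h2
    push_cast at h4
    omega
  rw [Pc, this, Finsupp.supported_empty]

def rk (p : ℕ) : ℕ := Module.finrank ℂ ↥((Pc 3 p 2).map (dd 3))

theorem hdim3_other {p : ℕ} {e : ℤ} (h : e < 0 ∨ 9 < e) : hdim 3 p e = 0 := by
  unfold hdim
  rw [Pc3_bot h, inf_bot_eq, finrank_bot, Nat.zero_sub]

theorem hdim3_two (p : ℕ) : hdim 3 p 2 = Nat.choose 12 p * 6 - rk p := by
  unfold hdim
  have h1 := finrank_map_add (dd 3) (Pc 3 p 2)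
  have h2 : Module.finrank ℂ (Pc 3 p 2) = Nat.choose 12 p * 6 := by
    rw [finrank_Pc]; exact AA3_ncard p 2
  rw [Pc3_bot (e := 2 - 4) (Or.inl (by norm_num)), Submodule.map_bot, finrank_bot]
  unfold rk
  omega

theorem hdim3_six (p : ℕ) : hdim 3 p 6 = Nat.choose 12 p * 10 - rk (p + 1) := by
  unfold hdim
  have h0 : Pc 3 p 6 ≤ LinearMap.ker (dd 3) := by
    intro x hx
    rw [LinearMap.mem_ker]
    rcases p with _ | p
    · exact dd_zero hx
    · have := dd_mem hx
      rwa [Pc3_bot (Or.inr (by norm_num)), Submodule.mem_bot] at this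
  have h2 : Module.finrank ℂ (Pc 3 p 6) = Nat.choose 12 p * 10 := by
    rw [finrank_Pc]; exact AA3_ncard p 6
  rw [inf_eq_right.2 h0, h2]
  rfl

theorem rk_zero : rk 0 = 0 := by
  unfold rk
  have : (Pc 3 0 2).map (dd 3) = ⊥ := by
    rw [eq_bot_iff]
    rintro _ ⟨x, hx, rfl⟩
    rw [dd_zero hx]; exact Submodule.zero_mem _
  rw [this, finrank_bot]

/-! ### Comparison with the computation -/

def code (g : Fin 3 → ℕ) : ℕ := g 0 + 8 * g 1 + 64 * g 2
def item (t : Fin 15) : ℕ × ℕ := (2 ^ (t.val + 3), code (mc t))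
def tl : List (Fin 15) := [14, 13, 12, 11, 10, 9, 8, 7, 6, 5, 4, 3]

theorem items_eq : items = tl.map item := by decide

def fl : List (Fin 3 → ℕ) :=
  [![0, 0, 2], ![0, 1, 1], ![1, 0, 1], ![0, 2, 0], ![1, 1, 0], ![2, 0, 0]]

theorem fs_eq : fs = fl.map code := by decide

theorem subs_cons (v : ℕ × ℕ) (vs) (p : ℕ) (acc) : subs (v :: vs) (p + 1) acc =
    subs vs (p + 1) acc ++ subs vs p (v :: acc) := rfl

theorem mem_subs (ts : List (Fin 15)) : ∀ (p : ℕ) (acc : List (Fin 15)) (l : List (ℕ × ℕ)),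
    l ∈ subs (ts.map item) p (acc.map item) ↔
      ∃ s : List (Fin 15), s.Sublist ts ∧ s.length = p ∧ l = (s.reverse ++ acc).map item := by
  induction ts with
  | nil =>
    intro p acc l
    rcases p with _ | p
    · change l ∈ [acc.map item] ↔ _
      rw [List.mem_singleton]
      constructor
      · rintro rfl; exact ⟨[], List.Sublist.refl _, rfl, rfl⟩
      · rintro ⟨s, hs, _, rfl⟩
        rw [List.sublist_nil.1 hs]; rfl
    · change l ∈ [] ↔ _
      simp only [List.not_mem_nil, false_iff]
      rintro ⟨s, hs, h, _⟩
      rw [List.sublist_nil.1 hs] at h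
      simp at h
  | cons v ts ih =>
    intro p acc l
    rcases p with _ | p
    · change l ∈ [acc.map item] ↔ _
      rw [List.mem_singleton]
      constructor
      · rintro rfl; exact ⟨[], List.nil_sublist _, rfl, rfl⟩
      · rintro ⟨s, hs, h, rfl⟩
        rw [List.length_eq_zero_iff.1 h]; rfl
    · rw [List.map_cons, subs_cons, List.mem_append, ih, ← List.map_cons, ih]
      constructor
      · rintro (⟨s, hs, h, rfl⟩ | ⟨s, hs, h, rfl⟩)
        · exact ⟨s, hs.cons _, h, rfl⟩
        · exact ⟨v :: s, hs.cons_cons _, by simp [h], by simp⟩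
      · rintro ⟨s, hs, h, rfl⟩
        rw [List.sublist_cons_iff] at hs
        rcases hs with hs | ⟨r, rfl, hr⟩
        · exact Or.inl ⟨s, hs, h, rfl⟩
        · exact Or.inr ⟨r, hr, by simpa using h, by simp⟩

/-- the set of index lists -/
def IsIx (p : ℕ) (l : List (Fin 15)) : Prop := l.Sublist tl.reverse ∧ l.length = p

theorem mem_rows (p : ℕ) (x : Vec) : x ∈ rows p ↔ ∃ l, IsIx p l ∧ ∃ g ∈ fl,
    x = rowAux (tot (l.map item)) (code g) (l.map item) false := by
  unfold rows
  rw [List.mem_flatMap]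
  constructor
  · rintro ⟨m, hm, hx⟩
    rw [items_eq] at hm
    obtain ⟨s, hs, h, rfl⟩ := (mem_subs tl p [] m).1 hm
    rw [List.mem_map] at hx
    obtain ⟨f, hf, rfl⟩ := hx
    rw [fs_eq, List.mem_map] at hf
    obtain ⟨g, hg, rfl⟩ := hf
    refine ⟨s.reverse, ⟨List.reverse_sublist.2 hs, by simpa using h⟩, g, hg, by simp⟩
  · rintro ⟨l, ⟨hl, h⟩, g, hg, rfl⟩
    refine ⟨l.map item, ?_, ?_⟩
    · rw [items_eq]
      refine (mem_subs tl p [] _).2 ⟨l.reverse, ?_, by simpa using h, by simp⟩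
      rw [← List.reverse_sublist, List.reverse_reverse]; exact hl
    · rw [List.mem_map]
      exact ⟨code g, by rw [fs_eq]; exact List.mem_map_of_mem hg, rfl⟩

theorem isIx_pairwise {p : ℕ} {l : List (Fin 15)} (h : IsIx p l) : l.Pairwise (· < ·) :=
  List.Pairwise.sublist h.1 (by decide)

theorem isIx_ge {p : ℕ} {l : List (Fin 15)} (h : IsIx p l) : ∀ t ∈ l, 3 ≤ t.val := by
  intro t ht
  have : ∀ t ∈ tl.reverse, 3 ≤ t.val := by decide
  exact this t (h.1.subset ht)

theorem exists_isIx {p : ℕ} {T : Finset (Fin 15)} (h1 : ∀ t ∈ T, 3 ≤ t.val) (h2 : T.card = p) :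
    ∃ l, IsIx p l ∧ l.toFinset = T := by
  have e : (tl.reverse.filter (· ∈ T)).toFinset = T := by
    ext t
    have : ∀ t : Fin 15, 3 ≤ t.val → t ∈ tl.reverse := by decide
    simp only [List.mem_toFinset, List.mem_filter, decide_eq_true_eq]
    exact ⟨fun h => h.2, fun h => ⟨this t (h1 t h), h⟩⟩
  refine ⟨_, ⟨List.filter_sublist, ?_⟩, e⟩
  rw [← h2, ← List.toFinset_card_of_nodup, e]
  exact List.Nodup.filter _ (by decide)

/-- alternating sums over sorted lists -/
theorem sum_cnt {M : Type*} [AddCommMonoid M] (l : List (Fin 15)) (hl : l.Pairwise (· < ·)) :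
    ∀ (G : Fin 15 → ℕ → M), ∑ t ∈ l.toFinset, G t (cnt l.toFinset t) =
      (List.rec (motive := fun _ => ℕ → M) (fun _ => 0) (fun t _ ih i => G t i + ih (i + 1)) l : ℕ → M) 0 := by
  induction l with
  | nil => intro G; simp
  | cons a l ih =>
    intro G
    rw [List.pairwise_cons] at hl
    have ha : a ∉ l.toFinset := by
      rw [List.mem_toFinset]; exact fun h => lt_irrefl _ (hl.1 a h)
    have c0 : cnt (insert a l.toFinset) a = 0 := by
      unfold cnt
      rw [Finset.card_eq_zero, Finset.filter_eq_empty_iff]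
      intro t ht
      rcases Finset.mem_insert.1 ht with rfl | ht
      · exact lt_irrefl _
      · exact not_lt.2 (hl.1 t (List.mem_toFinset.1 ht)).le
    rw [List.toFinset_cons, Finset.sum_insert ha, c0]
    change _ = G a 0 + _
    congr 1
    have shift : ∀ (m : List (Fin 15)) (i : ℕ), (List.rec (motive := fun _ => ℕ → M) (fun _ => 0)
        (fun t _ ih i => G t i + ih (i + 1)) m : ℕ → M) (i + 1) =
        (List.rec (motive := fun _ => ℕ → M) (fun _ => 0)
        (fun t _ ih i => G t (i + 1) + ih (i + 1)) m : ℕ → M) i := by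
      intro m
      induction m with
      | nil => intro i; rfl
      | cons b m ihm => intro i; exact congrArg (G b (i + 1) + ·) (ihm (i + 1))
    rw [shift, ← ih hl.2 (fun t i => G t (i + 1))]
    refine Finset.sum_congr rfl fun t ht => ?_
    rw [← cnt_erase_of_gt (Finset.mem_insert_self a _) (hl.1 t (List.mem_toFinset.1 ht)),
      Finset.erase_insert ha]

def key (a : Finset (Fin 15) × Ex) : ℕ := ∑ t ∈ a.1, 2 ^ (t.val + 3) + (a.2 0 + 8 * a.2 1)

/-- the contribution of one index to a row -/
def GG (K F : ℕ) (t : Fin 15) (i : ℕ) : ℕ →₀ ℂ :=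
  if Nat.land (code (mc t) + F) 292 = 0 then
    Finsupp.single (K - 2 ^ (t.val + 3) + (code (mc t) + F) % 64) ((-1 : ℂ) ^ (i + 1)) else 0

theorem srow_eq (k : ℕ) (s : ℤ) (r : Vec) : srow k s r = Vec.cons k s r := by
  cases k <;> exact scons_eq _ _ _

theorem sign_eq (i : ℕ) : (((Bool.rec (motive := fun _ => ℤ) (Int.negSucc 0) (Int.ofNat 1)
    (Nat.bodd i) : ℤ)) : ℂ) = (-1 : ℂ) ^ (i + 1) := by
  induction i with
  | zero => simp
  | succ i ih =>
    rw [Nat.bodd_succ, pow_succ, ← ih]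
    cases Nat.bodd i <;> simp

theorem ev_rowAux (K F : ℕ) (l : List (Fin 15)) : ∀ i : ℕ,
    ev (rowAux K F (l.map item) (Nat.bodd i)) =
      (List.rec (motive := fun _ => ℕ → (ℕ →₀ ℂ)) (fun _ => 0)
        (fun t _ ih i => GG K F t i + ih (i + 1)) l : ℕ → (ℕ →₀ ℂ)) i := by
  induction l with
  | nil => intro i; rfl
  | cons t l ih =>
    intro i
    change ev (Nat.rec (motive := fun _ => Vec)
      (srow (K - 2 ^ (t.val + 3) + (code (mc t) + F) % 64)
        (Bool.rec (motive := fun _ => ℤ) (Int.negSucc 0) (Int.ofNat 1) (Nat.bodd i))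
        (rowAux K F (l.map item) (not (Nat.bodd i))))
      (fun _ _ => rowAux K F (l.map item) (not (Nat.bodd i)))
      (Nat.land (code (mc t) + F) 292)) = GG K F t i + _
    rw [← Nat.bodd_succ]
    unfold GG
    cases h : Nat.land (code (mc t) + F) 292 with
    | zero =>
      change ev (srow _ _ _) = _
      rw [srow_eq, ev_cons, ih, sign_eq, if_pos rfl]; rfl
    | succ n =>
      change ev (rowAux K F (l.map item) (Nat.bodd (i + 1))) = _
      rw [ih, if_neg (Nat.succ_ne_zero n), zero_add]; rfl

theorem tot_eq (l : List (Fin 15)) (hl : l.Nodup) :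
    tot (l.map item) = ∑ t ∈ l.toFinset, 2 ^ (t.val + 3) := by
  induction l with
  | nil => rfl
  | cons t l ih =>
    rw [List.nodup_cons] at hl
    rw [List.toFinset_cons, Finset.sum_insert (by simpa using hl.1), ← ih hl.2]
    rfl

theorem code_facts : ∀ t : Fin 15, 3 ≤ t.val → ∀ g ∈ fl,
    (Nat.land (code (mc t) + code g) 292 = 0 ↔ ∀ i : Fin 3, mc t i + g i < 4) ∧
    ((∀ i : Fin 3, mc t i + g i < 4) → (code (mc t) + code g) % 64 =
      (mc t 0 + g 0) + 8 * (mc t 1 + g 1)) := by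
  decide

theorem ev_row {p : ℕ} {l : List (Fin 15)} (hl : IsIx p l) {g : Fin 3 → ℕ} (hg : g ∈ fl) :
    ev (rowAux (tot (l.map item)) (code g) (l.map item) false) =
      Finsupp.mapDomain key (ddb 3 (l.toFinset, Finsupp.equivFunOnFinite.symm g)) := by
  have h0 := ev_rowAux (tot (l.map item)) (code g) l 0
  have hp := isIx_pairwise hl
  rw [← sum_cnt l hp] at h0
  refine h0.trans ?_
  unfold ddb
  rw [← Finsupp.lmapDomain_apply ℂ ℂ, map_sum]
  refine Finset.sum_congr rfl fun t ht => ?_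
  obtain ⟨c1, c2⟩ := code_facts t (isIx_ge hl t (List.mem_toFinset.1 ht)) g hg
  have e1 : cls 3 (mon t + Finsupp.equivFunOnFinite.symm g) ↔ ∀ i : Fin 3, mc t i + g i < 4 := by
    constructor
    · intro h i; exact h i i.2
    · intro h i _; exact h i
  unfold GG
  simp only
  by_cases hc : ∀ i : Fin 3, mc t i + g i < 4
  · rw [if_pos (c1.2 hc), if_pos (e1.2 hc), Finsupp.lmapDomain_apply, Finsupp.mapDomain_single,
      c2 hc]
    unfold key sgn
    congr 2
    rw [tot_eq l hp.nodup]
    rw [← Finset.add_sum_erase _ _ ht, Nat.add_sub_cancel_left]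
  · rw [if_neg (fun h => hc (c1.1 h)), if_neg (fun h => hc (e1.1 h)), map_zero]

theorem fl_mem {f : Ex} (h : f.degree = 2) : (f : Fin 3 → ℕ) ∈ fl := by
  rw [degree3] at h
  have e : (f : Fin 3 → ℕ) = ![f 0, f 1, f 2] := by
    ext i; fin_cases i <;> rfl
  rw [e]
  generalize f 0 = a at *
  generalize f 1 = b at *
  generalize f 2 = c at *
  have ha : a ≤ 2 := by omega
  have hb : b ≤ 2 := by omega
  obtain rfl : c = 2 - a - b := by omega
  clear e
  interval_cases a <;> interval_cases b <;> first | omega | decide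

theorem fl_props : ∀ g ∈ fl, (∀ i : Fin 3, g i < 4) ∧ g 0 + g 1 + g 2 = 2 := by decide

theorem map_key (p : ℕ) : ((Pc 3 p 2).map (dd 3)).map (Finsupp.lmapDomain ℂ ℂ key) =
    Submodule.span ℂ {y | ∃ x ∈ rows p, ev x = y} := by
  unfold Pc
  rw [Finsupp.supported_eq_span_single, Submodule.map_span, Submodule.map_span]
  congr 1
  ext y
  constructor
  · rintro ⟨_, ⟨_, ⟨⟨T, f⟩, ⟨h1, h2, h3, h4⟩, rfl⟩, rfl⟩, rfl⟩
    obtain ⟨l, hl, rfl⟩ := exists_isIx h1 h2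
    have hf : (f : Fin 3 → ℕ) ∈ fl := fl_mem (by exact_mod_cast h4)
    refine ⟨_, (mem_rows p _).2 ⟨l, hl, f, hf, rfl⟩, ?_⟩
    rw [ev_row hl hf, dd_single, one_smul, Finsupp.lmapDomain_apply]
    congr 3
    exact Finsupp.equivFunOnFinite.symm_apply_apply f
  · rintro ⟨x, hx, rfl⟩
    obtain ⟨l, hl, g, hg, rfl⟩ := (mem_rows p _).1 hx
    obtain ⟨g1, g2⟩ := fl_props g hg
    refine ⟨_, ⟨_, ⟨(l.toFinset, Finsupp.equivFunOnFinite.symm g), ⟨?_, ?_, ?_, ?_⟩, rfl⟩, rfl⟩, ?_⟩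
    · intro t ht; exact isIx_ge hl t (List.mem_toFinset.1 ht)
    · simp only
      rw [List.toFinset_card_of_nodup (isIx_pairwise hl).nodup]; exact hl.2
    · intro i _; exact g1 i
    · rw [degree3]; exact_mod_cast g2
    · rw [ev_row hl hg, dd_single, one_smul, Finsupp.lmapDomain_apply]

theorem key_injOn (p : ℕ) : Set.InjOn key (AA 3 p 6) := by
  rintro ⟨T, f⟩ ⟨hT, _, hf1, hf2⟩ ⟨T', f'⟩ ⟨hT', _, hf1', hf2'⟩ h
  simp only [degree3] at hf2 hf2'
  have a0 := hf1 0 (by decide)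
  have a1 := hf1 1 (by decide)
  have b0 := hf1' 0 (by decide)
  have b1 := hf1' 1 (by decide)
  simp only [key] at h a0 a1 b0 b1
  have conv : ∀ T : Finset (Fin 15), ∑ t ∈ T, 2 ^ (t.val + 3) =
      8 * ∑ t ∈ T.map Fin.valEmbedding, 2 ^ t := by
    intro T
    rw [Finset.sum_map, Finset.mul_sum]
    refine Finset.sum_congr rfl fun t _ => ?_
    rw [pow_add]; simp [mul_comm]
  have dv : ∀ T : Finset (Fin 15), (∀ t ∈ T, 3 ≤ t.val) → 64 ∣ ∑ t ∈ T, 2 ^ (t.val + 3) := by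
    intro T hT
    refine Finset.dvd_sum fun t ht => ?_
    exact pow_dvd_pow 2 (show 6 ≤ t.val + 3 by have := hT t ht; omega)
  obtain ⟨u, hu⟩ := dv T hT
  obtain ⟨u', hu'⟩ := dv T' hT'
  have e0 : ∑ t ∈ T, 2 ^ (t.val + 3) = ∑ t ∈ T', 2 ^ (t.val + 3) := by omega
  rw [conv, conv] at e0
  have e1 := Finset.geomSum_injective (le_refl 2) (Nat.eq_of_mul_eq_mul_left (by norm_num) e0)
  rw [Finset.map_inj] at e1
  have e2 : f 0 = f' 0 := by omega
  have e3 : f 1 = f' 1 := by omega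
  have e4 : f 2 = f' 2 := by omega
  rw [Prod.mk.injEq]
  refine ⟨e1, ?_⟩
  ext i
  fin_cases i
  · exact e2
  · exact e3
  · exact e4

theorem rk_of_chk {p r : ℕ} (h : chk (p + 1) r = true) : rk (p + 1) = r := by
  rw [← chk_spec h, ← map_key]
  unfold rk
  symm
  have hle : (Pc 3 (p + 1) 2).map (dd 3) ≤ Pc 3 p 6 := by
    rintro _ ⟨x, hx, rfl⟩
    exact dd_mem hx
  have hker : LinearMap.ker (Finsupp.lmapDomain ℂ ℂ key) ⊓ (Pc 3 (p + 1) 2).map (dd 3) = ⊥ := by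
    rw [eq_bot_iff]
    rintro x ⟨h1, h2⟩
    have h3 := hle h2
    rw [Submodule.mem_bot]
    refine Finsupp.mapDomain_injOn (AA 3 p 6) (key_injOn p) ?_ ?_ ?_
    · exact (Finsupp.mem_supported ℂ _).1 h3
    · simp
    · rw [Finsupp.mapDomain_zero]; exact h1
  have := finrank_map_add (Finsupp.lmapDomain ℂ ℂ key) ((Pc 3 (p + 1) 2).map (dd 3))
  rw [hker, finrank_bot, add_zero] at this
  exact this

/-! ### Comparison with the intrinsic Koszul complex -/

theorem mem_Sdeg_monomial (e : ℤ) (f : Ex) (h : (f.degree : ℤ) = e) :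
    (MvPolynomial.monomial f (1 : ℂ)) ∈ Sdeg 3 e := by
  have h0 : 0 ≤ e := by omega
  rw [Sdeg, if_pos h0, MvPolynomial.mem_homogeneousSubmodule]
  exact MvPolynomial.isHomogeneous_monomial _ (by omega)

theorem Sdeg_support (e : ℤ) (x : PolyC 3) (hx : x ∈ Sdeg 3 e) (f : Ex) (hf : f ∈ x.support) :
    (f.degree : ℤ) = e := by
  rw [Sdeg] at hx
  split_ifs at hx with h0
  · rw [MvPolynomial.mem_homogeneousSubmodule] at hx
    have := hx (MvPolynomial.mem_support_iff.1 hf)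
    have h2 : Finsupp.weight (1 : Fin 3 → ℕ) f = f.degree := by
      rw [Finsupp.degree_eq_weight_one]; rfl
    rw [h2] at this
    omega
  · rw [Submodule.mem_bot] at hx
    subst hx
    simp at hf

abbrev IE (e : ℤ) := {f : Ex // (f.degree : ℤ) = e}

def vE (e : ℤ) (f : IE e) : Sdeg 3 e := ⟨MvPolynomial.monomial f.1 (1 : ℂ), mem_Sdeg_monomial e f.1 f.2⟩

def bE (e : ℤ) : Module.Basis (IE e) ℂ (Sdeg 3 e) := by
  refine Module.Basis.mk (v := vE e) ?_ ?_
  · apply LinearIndependent.of_comp (Sdeg 3 e).subtype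
    have := (MvPolynomial.basisMonomials (Fin 3) ℂ).linearIndependent.comp
      (fun f : IE e => f.1) Subtype.val_injective
    have h2 : (Sdeg 3 e).subtype ∘ vE e =
        (MvPolynomial.basisMonomials (Fin 3) ℂ) ∘ fun f : IE e => f.1 := by
      funext f
      simp [vE]
    rw [h2]
    exact this
  · rintro ⟨x, hx⟩ -
    have : (⟨x, hx⟩ : Sdeg 3 e) = ∑ f : x.support, (x.coeff f.1) •
        vE e ⟨f.1, Sdeg_support e x hx f.1 f.2⟩ := by
      apply Subtype.ext
      rw [AddSubmonoidClass.coe_finsetSum]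
      simp only [Submodule.coe_smul, vE]
      rw [Finset.sum_coe_sort x.support (fun f => x.coeff f • MvPolynomial.monomial f (1 : ℂ))]
      conv_lhs => rw [MvPolynomial.as_sum x]
      refine Finset.sum_congr rfl fun f _ => ?_
      rw [MvPolynomial.smul_monomial, smul_eq_mul, mul_one]
    rw [this]
    exact Submodule.sum_mem _ fun f _ => Submodule.smul_mem _ _ (Submodule.subset_span ⟨_, rfl⟩)

theorem bE_apply (e : ℤ) (f : IE e) : bE e f = vE e f := by
  rw [bE, Module.Basis.mk_apply]

theorem mc_inj : Function.Injective mc := by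
  intro a b; revert a b; decide

theorem mc_surj : ∀ a b c : Fin 5, a.val + b.val + c.val = 4 →
    ∃ t, mc t 0 = a.val ∧ mc t 1 = b.val ∧ mc t 2 = c.val := by
  decide

def e15 : Fin 15 ≃ IE 4 := by
  refine Equiv.ofBijective (fun t => ⟨mon t, by rw [mon_degree]; rfl⟩) ⟨?_, ?_⟩
  · intro a b h
    apply mc_inj
    exact Finsupp.equivFunOnFinite.symm.injective (congrArg Subtype.val h)
  · rintro ⟨f, hf⟩
    have h := hf
    rw [Finsupp.degree_eq_sum, Fin.sum_univ_three] at h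
    obtain ⟨t, h0, h1, h2⟩ := mc_surj ⟨f 0, by omega⟩ ⟨f 1, by omega⟩ ⟨f 2, by omega⟩
      (by simp only []; omega)
    refine ⟨t, Subtype.ext ?_⟩
    ext i
    fin_cases i
    · exact h0
    · exact h1
    · exact h2

def bV : Module.Basis (Fin 15) ℂ (Sdeg 3 4) := (bE 4).reindex e15.symm

theorem bV_coe (t : Fin 15) : (bV t : PolyC 3) = MvPolynomial.monomial (mon t) 1 := by
  rw [bV, Module.Basis.reindex_apply, bE_apply]
  rfl

abbrev IX (p : ℕ) (e : ℤ) := Set.powersetCard (Fin 15) p × IE e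

def bK (p : ℕ) (e : ℤ) : Module.Basis (IX p e) ℂ (KosModule 3 4 p e) :=
  (bV.exteriorPower p).tensorProduct (bE e)

theorem bK_apply (p : ℕ) (e : ℤ) (s : IX p e) :
    bK p e s = wedgeE ℂ ↥(Sdeg 3 4) p (fun i => bV (s.1.1.orderEmbOfFin s.1.2 i)) ⊗ₜ[ℂ] vE e s.2 := by
  rw [bK, Module.Basis.tensorProduct_apply, bE_apply, exteriorPower.basis_apply]
  rfl

def ix (p : ℕ) (e : ℤ) (s : IX p e) : Finset (Fin 15) × Ex := (s.1.1, s.2.1)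

theorem ix_inj (p : ℕ) (e : ℤ) : Function.Injective (ix p e) := by
  rintro ⟨⟨a, ha⟩, ⟨b, hb⟩⟩ ⟨⟨a', ha'⟩, ⟨b', hb'⟩⟩ h
  simp only [ix, Prod.mk.injEq] at h
  obtain ⟨rfl, rfl⟩ := h
  rfl

def Phi (p : ℕ) (e : ℤ) : KosModule 3 4 p e →ₗ[ℂ] XX :=
  Finsupp.lmapDomain ℂ ℂ (ix p e) ∘ₗ (bK p e).repr.toLinearMap

theorem Phi_basis (p : ℕ) (e : ℤ) (s : IX p e) :
    Phi p e (bK p e s) = Finsupp.single (ix p e s) 1 := by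
  simp [Phi, Finsupp.lmapDomain_apply, Finsupp.mapDomain_single]

theorem Phi_inj (p : ℕ) (e : ℤ) : Function.Injective (Phi p e) := by
  intro x y h
  exact (bK p e).repr.injective (Finsupp.mapDomain_injective (ix_inj p e) h)

theorem Phi_range (p : ℕ) (e : ℤ) : LinearMap.range (Phi p e) = Pc 0 p e := by
  rw [LinearMap.range_eq_map, ← (bK p e).span_eq, Submodule.map_span, Pc,
    Finsupp.supported_eq_span_single]
  congr 1
  ext x
  constructor
  · rintro ⟨_, ⟨s, rfl⟩, rfl⟩
    refine ⟨ix p e s, ⟨fun _ _ => Nat.zero_le _, s.1.2, fun i hi => absurd hi (Nat.not_lt_zero _), s.2.2⟩, ?_⟩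
    exact (Phi_basis p e s).symm
  · rintro ⟨⟨T, f⟩, ⟨_, h1, _, h2⟩, rfl⟩
    exact ⟨_, ⟨(⟨T, h1⟩, ⟨f, h2⟩), rfl⟩, Phi_basis p e _⟩

theorem cnt_orderEmb {p : ℕ} (T : Finset (Fin 15)) (h : T.card = p) (k : Fin p) :
    cnt T (T.orderEmbOfFin h k) = k.val := by
  have : T.filter (· < T.orderEmbOfFin h k) =
      (Finset.univ.filter (· < k)).map (T.orderEmbOfFin h).toEmbedding := by
    ext t
    simp only [Finset.mem_filter, Finset.mem_map, Finset.mem_univ, true_and]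
    constructor
    · rintro ⟨ht, hlt⟩
      rw [← Finset.mem_coe, ← Finset.range_orderEmbOfFin T h] at ht
      obtain ⟨j, rfl⟩ := ht
      exact ⟨j, (T.orderEmbOfFin h).lt_iff_lt.1 hlt, rfl⟩
    · rintro ⟨j, hj, rfl⟩
      exact ⟨Finset.orderEmbOfFin_mem T h j, (T.orderEmbOfFin h).lt_iff_lt.2 hj⟩
  rw [cnt, this, Finset.card_map]
  have h2 : (Finset.univ.filter (· < k)) = Finset.Iio k := by ext; simp
  rw [h2, Fin.card_Iio]

theorem erase_card {p : ℕ} (T : Finset (Fin 15)) (h : T.card = p + 1) (k : Fin (p + 1)) :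
    (T.erase (T.orderEmbOfFin h k)).card = p := by
  rw [Finset.card_erase_of_mem (Finset.orderEmbOfFin_mem T h k), h]; rfl

theorem erase_orderEmb {p : ℕ} (T : Finset (Fin 15)) (h : T.card = p + 1) (k : Fin (p + 1))
    (i : Fin p) : T.orderEmbOfFin h (k.succAbove i) =
      (T.erase (T.orderEmbOfFin h k)).orderEmbOfFin (erase_card T h k) i := by
  have := Finset.orderEmbOfFin_unique (erase_card T h k)
    (f := fun i => T.orderEmbOfFin h (k.succAbove i)) (fun i => by
      rw [Finset.mem_erase]
      refine ⟨fun hh => Fin.succAbove_ne k i ((T.orderEmbOfFin h).injective hh),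
        Finset.orderEmbOfFin_mem T h _⟩)
    (fun a b hab => (T.orderEmbOfFin h).strictMono (Fin.strictMono_succAbove k hab))
  exact congrFun this i

theorem incl_inj (p : ℕ) (e : ℤ) : Function.Injective
    (TensorProduct.map (LinearMap.id (R := ℂ) (M := ↥(⋀[ℂ]^p ↥(Sdeg 3 4))))
      (Sdeg 3 e).subtype) :=
  Module.Flat.lTensor_preserves_injective_linearMap (Sdeg 3 e).subtype
    (Submodule.injective_subtype _)

theorem D_basis (D : KFam 3 4) (hD : IsKoszulFam 3 4 D) (p : ℕ) (e e' : ℤ) (he : e' = e + 4)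
    (s : IX (p + 1) e) :
    D p e e' (bK (p + 1) e s) = ∑ k : Fin (p + 1), ((-1 : ℂ) ^ ((k : ℕ) + 1)) •
      bK p e' (⟨_, erase_card s.1.1 s.1.2 k⟩, ⟨mon (s.1.1.orderEmbOfFin s.1.2 k) + s.2.1, by
        have := s.2.2; rw [map_add, mon_degree]; push_cast; omega⟩) := by
  apply incl_inj p e'
  rw [bK_apply, hD p e e' he, map_sum]
  refine Finset.sum_congr rfl fun k _ => ?_
  rw [map_smul, bK_apply, TensorProduct.map_tmul]
  congr 2
  · simp only [LinearMap.id_apply]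
    congr 1
    funext i
    rw [erase_orderEmb s.1.1 s.1.2 k i]
  · rw [bV_coe]
    simp [vE, MvPolynomial.monomial_mul]

theorem Phi_D (D : KFam 3 4) (hD : IsKoszulFam 3 4 D) (p : ℕ) (e e' : ℤ) (he : e' = e + 4)
    (x : KosModule 3 4 (p + 1) e) :
    Phi p e' (D p e e' x) = dd 0 (Phi (p + 1) e x) := by
  have : Phi p e' ∘ₗ D p e e' = dd 0 ∘ₗ Phi (p + 1) e := by
    apply (bK (p + 1) e).ext
    intro s
    rw [LinearMap.comp_apply, LinearMap.comp_apply, D_basis D hD p e e' he, Phi_basis, dd_single,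
      one_smul, map_sum, ddb]
    have hT : (ix (p + 1) e s).1 =
        Finset.univ.map (s.1.1.orderEmbOfFin s.1.2).toEmbedding := by
      rw [← Finset.coe_inj, Finset.coe_map, Finset.coe_univ, Set.image_univ]
      exact (Finset.range_orderEmbOfFin s.1.1 s.1.2).symm
    conv_rhs => rw [hT]
    rw [Finset.sum_map, ← hT]
    refine Finset.sum_congr rfl fun k _ => ?_
    have hc : ∀ f : Ex, cls 0 f := fun f i hi => absurd hi (Nat.not_lt_zero _)
    rw [if_pos (hc _), map_smul, Phi_basis,
      Finsupp.smul_single, smul_eq_mul, mul_one, sgn]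
    congr 2
    exact congrArg (· + 1) (cnt_orderEmb s.1.1 s.1.2 k).symm
  exact LinearMap.congr_fun this x

theorem map_range_D (D : KFam 3 4) (hD : IsKoszulFam 3 4 D) (p : ℕ) (e e' : ℤ) (he : e' = e + 4) :
    (LinearMap.range (D p e e')).map (Phi p e') = (Pc 0 (p + 1) e).map (dd 0) := by
  rw [← Phi_range, ← LinearMap.range_comp, ← LinearMap.range_comp]
  congr 1
  refine LinearMap.ext fun x => ?_
  exact Phi_D D hD p e e' he x

theorem map_ker_D (D : KFam 3 4) (hD : IsKoszulFam 3 4 D) (p : ℕ) (e e' : ℤ) (he : e' = e + 4) :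
    (LinearMap.ker (D p e e')).map (Phi (p + 1) e) = LinearMap.ker (dd 0) ⊓ Pc 0 (p + 1) e := by
  ext y
  constructor
  · rintro ⟨x, hx, rfl⟩
    refine ⟨?_, ?_⟩
    · change dd 0 _ = 0
      rw [← Phi_D D hD p e e' he, LinearMap.mem_ker.1 hx, map_zero]
    · rw [← Phi_range]; exact ⟨x, rfl⟩
  · rintro ⟨h1, h2⟩
    rw [SetLike.mem_coe, ← Phi_range] at h2
    obtain ⟨x, rfl⟩ := h2
    refine ⟨x, ?_, rfl⟩
    apply Phi_inj p e'
    rw [Phi_D D hD p e e' he, map_zero]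
    exact h1

theorem cdim_map (p : ℕ) (e : ℤ) (W : Submodule ℂ (KosModule 3 4 p e)) :
    cdim W = Module.finrank ℂ ↥(W.map (Phi p e)) :=
  (LinearEquiv.finrank_eq (Submodule.equivMapOfInjective (Phi p e) (Phi_inj p e) W))

theorem Kdim_eq (D : KFam 3 4) (hD : IsKoszulFam 3 4 D) (p : ℕ) (q : ℤ) :
    Kdim 3 4 D 2 p q = hdim 3 p (2 + q * 4) := by
  have hE : (2 : ℤ) + q * 4 = 2 + (q - 1) * 4 + 4 := by ring
  have hE1 : (2 : ℤ) + (q + 1) * 4 = 2 + q * 4 + 4 := by ring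
  have hE2 : (2 : ℤ) + q * 4 - 4 = 2 + (q - 1) * 4 := by ring
  rw [← hdim_zero_eq, hdim, hE2]
  cases p with
  | zero =>
    rw [Kdim, cdim_map, map_range_D D hD _ _ _ hE]
    congr 1
    have h1 : cdim (KosModule 3 4 0 (2 + q * 4)) =
        Module.finrank ℂ ↥(LinearMap.range (Phi 0 (2 + q * 4))) :=
      (LinearMap.finrank_range_of_inj (Phi_inj _ _)).symm
    rw [h1, Phi_range]
    have h2 : LinearMap.ker (dd 0) ⊓ Pc 0 0 (2 + q * 4) = Pc 0 0 (2 + q * 4) :=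
      inf_eq_right.2 fun x hx => dd_zero hx
    rw [h2]
  | succ p =>
    rw [Kdim, cdim_map, cdim_map, map_ker_D D hD _ _ _ hE1,
      Submodule.map_inf _ (Phi_inj _ _), map_ker_D D hD _ _ _ hE1, map_range_D D hD _ _ _ hE]
    have h2 : (Pc 0 (p + 1 + 1) (2 + (q - 1) * 4)).map (dd 0) ≤
        LinearMap.ker (dd 0) ⊓ Pc 0 (p + 1) (2 + q * 4) := by
      rintro _ ⟨x, hx, rfl⟩
      refine ⟨dd_dd _ _, ?_⟩
      rw [hE]
      exact dd_mem hx
    rw [inf_eq_left.2 h2]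

set_option maxRecDepth 100000

theorem chk1 : chk 1 10 = true := by decide +kernel
theorem chk2 : chk 2 120 = true := by decide +kernel
theorem chk3 : chk 3 660 = true := by decide +kernel
theorem chk4 : chk 4 2145 = true := by decide +kernel
theorem chk5 : chk 5 4500 = true := by decide +kernel
theorem chk6 : chk 6 5544 = true := by decide +kernel
theorem chk7 : chk 7 4752 = true := by decide +kernel
theorem chk8 : chk 8 2970 = true := by decide +kernel
theorem chk9 : chk 9 1320 = true := by decide +kernel
theorem chk10 : chk 10 396 = true := by decide +kernel
theorem chk11 : chk 11 72 = true := by decide +kernel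
theorem chk12 : chk 12 6 = true := by decide +kernel
theorem chk13 : chk 13 0 = true := by decide +kernel

end VB

end

/-- Betti table of the pushforward of O(b=2) under the 4-uple Veronese embedding of P^2. -/
theorem veronese_betti_P2_b2_d4 (D : KFam 3 4) (hD : IsKoszulFam 3 4 D) :
    Kdim 3 4 D 2 0 0 = 6 ∧
    Kdim 3 4 D 2 1 0 = 62 ∧
    Kdim 3 4 D 2 2 0 = 276 ∧
    Kdim 3 4 D 2 3 0 = 660 ∧
    Kdim 3 4 D 2 4 0 = 825 ∧
    Kdim 3 4 D 2 5 0 = 252 ∧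
    Kdim 3 4 D 2 3 1 = 55 ∧
    Kdim 3 4 D 2 4 1 = 450 ∧
    Kdim 3 4 D 2 5 1 = 2376 ∧
    Kdim 3 4 D 2 6 1 = 4488 ∧
    Kdim 3 4 D 2 7 1 = 4950 ∧
    Kdim 3 4 D 2 8 1 = 3630 ∧
    Kdim 3 4 D 2 9 1 = 1804 ∧
    Kdim 3 4 D 2 10 1 = 588 ∧
    Kdim 3 4 D 2 11 1 = 114 ∧
    Kdim 3 4 D 2 12 1 = 10 ∧
    (∀ (p : ℕ) (q : ℤ), ¬((p ≤ 5 ∧ q = 0) ∨ (3 ≤ p ∧ p ≤ 12 ∧ q = 1)) →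
      Kdim 3 4 D 2 p q = 0) := by
  have k0 : ∀ p, Kdim 3 4 D 2 p 0 = Nat.choose 12 p * 6 - VB.rk p := fun p => by
    rw [VB.Kdim_eq D hD, ← VB.hdim3_two]; norm_num
  have k1 : ∀ p, Kdim 3 4 D 2 p 1 = Nat.choose 12 p * 10 - VB.rk (p + 1) := fun p => by
    rw [VB.Kdim_eq D hD, ← VB.hdim3_six]; norm_num
  have r0 := VB.rk_zero
  have r1 := VB.rk_of_chk VB.chk1
  have r2 := VB.rk_of_chk VB.chk2
  have r3 := VB.rk_of_chk VB.chk3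
  have r4 := VB.rk_of_chk VB.chk4
  have r5 := VB.rk_of_chk VB.chk5
  have r6 := VB.rk_of_chk VB.chk6
  have r7 := VB.rk_of_chk VB.chk7
  have r8 := VB.rk_of_chk VB.chk8
  have r9 := VB.rk_of_chk VB.chk9
  have r10 := VB.rk_of_chk VB.chk10
  have r11 := VB.rk_of_chk VB.chk11
  have r12 := VB.rk_of_chk VB.chk12
  norm_num only at r1 r2 r3 r4 r5 r6 r7 r8 r9 r10 r11 r12
  have c : Nat.choose 12 0 = 1 ∧ Nat.choose 12 1 = 12 ∧ Nat.choose 12 2 = 66 ∧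
      Nat.choose 12 3 = 220 ∧ Nat.choose 12 4 = 495 ∧ Nat.choose 12 5 = 792 ∧
      Nat.choose 12 6 = 924 ∧ Nat.choose 12 7 = 792 ∧ Nat.choose 12 8 = 495 ∧
      Nat.choose 12 9 = 220 ∧ Nat.choose 12 10 = 66 ∧ Nat.choose 12 11 = 12 ∧
      Nat.choose 12 12 = 1 := by decide
  obtain ⟨c0, c1, c2, c3, c4, c5, c6, c7, c8, c9, c10, c11, c12⟩ := c
  have k1' : Kdim 3 4 D 2 12 1 = 10 := by
    rw [k1, c12]
    have : VB.rk 13 = 0 := by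
      have h := VB.rk_of_chk (p := 12) (r := 0) VB.chk13
      exact h
    norm_num [this]
  refine ⟨?_, ?_, ?_, ?_, ?_, ?_, ?_, ?_, ?_, ?_, ?_, ?_, ?_, ?_, ?_, k1', ?_⟩
  · rw [k0, c0, r0]
  · rw [k0, c1, r1]
  · rw [k0, c2, r2]
  · rw [k0, c3, r3]
  · rw [k0, c4, r4]
  · rw [k0, c5, r5]
  · rw [k1, c3, r4]
  · rw [k1, c4, r5]
  · rw [k1, c5, r6]
  · rw [k1, c6, r7]
  · rw [k1, c7, r8]
  · rw [k1, c8, r9]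
  · rw [k1, c9, r10]
  · rw [k1, c10, r11]
  · rw [k1, c11, r12]
  · intro p q hpq
    by_cases h0 : q = 0
    · subst h0
      have hp : 6 ≤ p := by omega
      rw [k0]
      by_cases h13 : 13 ≤ p
      · rw [Nat.choose_eq_zero_of_lt (by omega)]; simp
      · interval_cases p
        · rw [c6, r6]
        · rw [c7, r7]
        · rw [c8, r8]
        · rw [c9, r9]
        · rw [c10, r10]
        · rw [c11, r11]
        · rw [c12, r12]
    · by_cases h1 : q = 1
      · subst h1
        rw [k1]
        by_cases h13 : 13 ≤ p
        · rw [Nat.choose_eq_zero_of_lt (by omega)]; simp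
        · have hp : p ≤ 2 := by omega
          interval_cases p
          · rw [c0, r1]
          · rw [c1, r2]
          · rw [c2, r3]
      · rw [VB.Kdim_eq D hD]
        exact VB.hdim3_other (by omega)
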